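/- arXiv:2002.05414 — 8 statements merged into one kernel-verified Lean document; each statement's English description precedes it below -/
import Mathlib

section
/- There is an absolute constant C > 0 with the following property. Let α > 0 and let P be an α-spaced set of n ≥ 3 points in the hyperbolic plane ℍ. Then there exists a geodesic line L ⊆ ℍ such that: (a) every connected component of the complement ℍ \ L contains at most (2/3)·n points of P; and (b) for every optimal tour x : Fin n → ℍ whose image is P, the number of indices k ∈ Fin n for which some point of L is metrically between x k and x (k+1) (indices mod n) is at most C · max(1, 1/α) · Real.log n. -/
open UpperHalfPlane

lemma aux_two_opt {n : ℕ} (D : Fin n → Fin n → ℝ) (hD : ∀ i j, D i j = D j i)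
    (e : Fin n) (he : e.val = 1)
    (hopt : ∀ σ : Equiv.Perm (Fin n), ∑ k : Fin n, D k (k + e) ≤ ∑ k : Fin n, D (σ k) (σ (k + e)))
    (k l : Fin n) (hkl : k < l) :
    D k (k + e) + D l (l + e) ≤ D k l + D (k + e) (l + e) := by
  have hv : ∀ i : Fin n, (i + e).val = if i.val + 1 = n then 0 else i.val + 1 := by
    intro i
    rw [Fin.val_add, he]
    split_ifs with h
    · rw [h, Nat.mod_self]
    · exact Nat.mod_eq_of_lt (by omega)
  have hkl' : k.val < l.val := hkl
  let s : Fin n → Fin n := fun i =>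
    if h : k.val + 1 ≤ i.val ∧ i.val ≤ l.val then ⟨k.val + 1 + l.val - i.val, by omega⟩ else i
  have hs : ∀ i, (s i).val = if k.val + 1 ≤ i.val ∧ i.val ≤ l.val then k.val + 1 + l.val - i.val else i.val := by
    intro i
    simp only [s]
    split_ifs <;> rfl
  have hsi : Function.Involutive s := by
    intro i
    apply Fin.ext
    rw [hs, hs]
    split_ifs <;> omega
  let p : Fin n → Fin n := fun i =>
    if h : k.val < i.val ∧ i.val < l.val then ⟨k.val + l.val - i.val, by omega⟩ else i
  have hp : ∀ i, (p i).val = if k.val < i.val ∧ i.val < l.val then k.val + l.val - i.val else i.val := by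
    intro i
    simp only [p]
    split_ifs <;> rfl
  have hpi : Function.Involutive p := by
    intro i
    apply Fin.ext
    rw [hp, hp]
    split_ifs <;> omega
  have h1 := hopt hsi.toPerm
  simp only [Function.Involutive.coe_toPerm] at h1
  have h2 : ∑ i, D i (i + e) = ∑ i, D (p i) (p i + e) :=
    (Equiv.sum_comp hpi.toPerm (fun i => D i (i + e))).symm
  rw [h2] at h1
  have hlk : l ≠ k := fun h => by rw [h] at hkl'; omega
  have hsplit : ∀ f : Fin n → ℝ, ∑ i, f i = f k + (f l + ∑ i ∈ (Finset.univ.erase k).erase l, f i) := by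
    intro f
    rw [Finset.add_sum_erase _ _ (by simp [hlk]), Finset.add_sum_erase _ _ (by simp)]
  rw [hsplit, hsplit] at h1
  have e1 : p k = k := Fin.ext (by rw [hp]; split_ifs <;> omega)
  have e2 : p l = l := Fin.ext (by rw [hp]; split_ifs <;> omega)
  have e3 : s k = k := Fin.ext (by rw [hs]; split_ifs <;> omega)
  have e4 : s (k + e) = l := Fin.ext (by rw [hs, hv]; split_ifs <;> omega)
  have e5 : s l = k + e := Fin.ext (by rw [hs, hv]; split_ifs <;> omega)
  have e6 : s (l + e) = l + e := Fin.ext (by rw [hs, hv]; split_ifs <;> omega)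
  have h3 : ∑ i ∈ (Finset.univ.erase k).erase l, D (p i) (p i + e) =
      ∑ i ∈ (Finset.univ.erase k).erase l, D (s i) (s (i + e)) := by
    apply Finset.sum_congr rfl
    intro i hi
    simp only [Finset.mem_erase, Finset.mem_univ, and_true] at hi
    have a1 : i.val ≠ l.val := fun h => hi.1 (Fin.ext h)
    have a2 : i.val ≠ k.val := fun h => hi.2 (Fin.ext h)
    by_cases h : k.val < i.val ∧ i.val < l.val
    · rw [hD]
      congr 1
      · apply Fin.ext; rw [hs, hv, hp]; split_ifs <;> omega
      · apply Fin.ext; rw [hs, hv, hp]; split_ifs <;> omega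
    · congr 1
      · apply Fin.ext; rw [hs, hp]; split_ifs <;> omega
      · apply Fin.ext; rw [hs, hv, hv, hp]; split_ifs <;> omega
  rw [h3, e1, e2, e3, e4, e5, e6] at h1
  linarith

lemma aux_mid (w a : ℍ) (r : ℝ) (hr : 0 < r) (hra : r ≤ dist w a) :
    ∃ m : ℍ, dist w m = r ∧ dist m a = dist w a - r := by
  set d := dist w a with hd
  have hd0 : 0 < d := lt_of_lt_of_le hr hra
  have hsd : 0 < Real.sinh d := Real.sinh_pos_iff.2 hd0
  have hsr : 0 < Real.sinh r := Real.sinh_pos_iff.2 hr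
  have hsdr : 0 ≤ Real.sinh (d - r) := Real.sinh_nonneg_iff.2 (by linarith)
  set A := Real.sinh (d - r) / Real.sinh d with hA
  set B := Real.sinh r / Real.sinh d with hB
  have hA0 : 0 ≤ A := by positivity
  have hB0 : 0 < B := by positivity
  have hcd : Real.cosh d * (2 * w.im * a.im) = (w.re - a.re) ^ 2 + w.im ^ 2 + a.im ^ 2 := by
    rw [hd, cosh_dist']
    have := w.im_pos; have := a.im_pos
    field_simp
  have hcs : Real.cosh d ^ 2 = Real.sinh d ^ 2 + 1 := Real.cosh_sq d
  have hcr : Real.cosh r ^ 2 = Real.sinh r ^ 2 + 1 := Real.cosh_sq r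
  have hAe : A * Real.sinh d = Real.sinh d * Real.cosh r - Real.cosh d * Real.sinh r := by
    rw [hA, div_mul_cancel₀ _ hsd.ne', Real.sinh_sub]
  have hBe : B * Real.sinh d = Real.sinh r := by rw [hB, div_mul_cancel₀ _ hsd.ne']
  have h1 : A + B * Real.cosh d = Real.cosh r := by
    apply mul_right_cancel₀ hsd.ne'
    linear_combination hAe + Real.cosh d * hBe
  have h2 : A * Real.cosh d + B = Real.cosh (d - r) := by
    rw [Real.cosh_sub]
    apply mul_right_cancel₀ hsd.ne'
    linear_combination Real.cosh d * hAe + hBe - Real.sinh r * hcs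
  have h3 : A ^ 2 + B ^ 2 + 2 * A * B * Real.cosh d = 1 := by
    have : A = Real.cosh r - B * Real.cosh d := by linarith
    rw [this]
    have hB2 : B ^ 2 * Real.sinh d ^ 2 = Real.sinh r ^ 2 := by rw [← hBe]; ring
    linear_combination hcr - hB2 - B ^ 2 * hcs
  have hw := w.im_pos
  have ha := a.im_pos
  set V := A / w.im + B / a.im with hV
  have hV0 : 0 < V := by positivity
  set U := A * w.re / w.im + B * a.re / a.im with hU
  have hV' : V * (w.im * a.im) = A * a.im + B * w.im := by rw [hV]; field_simp
  have hU' : U * (w.im * a.im) = A * w.re * a.im + B * a.re * w.im := by rw [hU]; field_simp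
  set W := A * (w.re ^ 2 + w.im ^ 2) / w.im + B * (a.re ^ 2 + a.im ^ 2) / a.im with hW
  have hW' : W * (w.im * a.im) = A * (w.re ^ 2 + w.im ^ 2) * a.im + B * (a.re ^ 2 + a.im ^ 2) * w.im := by
    rw [hW]; field_simp
  have h4 : W * V = U ^ 2 + 1 := by
    have hne : (w.im * a.im) ^ 2 ≠ 0 := by positivity
    apply mul_right_cancel₀ hne
    have : W * V * (w.im * a.im) ^ 2 = (W * (w.im * a.im)) * (V * (w.im * a.im)) := by ring
    rw [this, hW', hV']
    have : (U ^ 2 + 1) * (w.im * a.im) ^ 2 = (U * (w.im * a.im)) ^ 2 + (w.im * a.im) ^ 2 := by ring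
    rw [this, hU']
    linear_combination (w.im * a.im) ^ 2 * h3 - A * B * w.im * a.im * hcd
  let m : ℍ := ⟨⟨U / V, 1 / V⟩, by simp; positivity⟩
  have hmre : m.re = U / V := rfl
  have hmim : m.im = 1 / V := rfl
  refine ⟨m, ?_, ?_⟩
  · have : Real.cosh (dist w m) = Real.cosh r := by
      rw [cosh_dist', hmre, hmim, ← h1, div_eq_iff (by positivity)]
      have key : V * (w.re ^ 2 + w.im ^ 2) - 2 * U * w.re + W = (A + B * Real.cosh d) * (2 * w.im) := by
        apply mul_right_cancel₀ (show w.im * a.im ≠ 0 by positivity)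
        linear_combination (w.re ^ 2 + w.im ^ 2) * hV' - 2 * w.re * hU' + hW' - B * w.im * hcd
      field_simp
      linear_combination V * key - h4
    exact Real.cosh_injOn (Set.mem_Ici.2 dist_nonneg) (Set.mem_Ici.2 hr.le) this
  · have : Real.cosh (dist m a) = Real.cosh (d - r) := by
      rw [cosh_dist', hmre, hmim, ← h2, div_eq_iff (by positivity)]
      have key : V * (a.re ^ 2 + a.im ^ 2) - 2 * U * a.re + W = (A * Real.cosh d + B) * (2 * a.im) := by
        apply mul_right_cancel₀ (show w.im * a.im ≠ 0 by positivity)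
        linear_combination (a.re ^ 2 + a.im ^ 2) * hV' - 2 * a.re * hU' + hW' - A * a.im * hcd
      field_simp
      linear_combination V * key - h4
    exact Real.cosh_injOn (Set.mem_Ici.2 dist_nonneg) (Set.mem_Ici.2 (sub_nonneg.2 hra)) this

noncomputable def auxLine (t : ℝ) : ℍ := ⟨⟨0, Real.exp t⟩, Real.exp_pos t⟩

lemma auxLine_re (t : ℝ) : (auxLine t).re = 0 := rfl
lemma auxLine_im (t : ℝ) : (auxLine t).im = Real.exp t := rfl

lemma auxLine_dist (s t : ℝ) : dist (auxLine s) (auxLine t) = |s - t| := by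
  rw [UpperHalfPlane.dist_of_re_eq (by rfl), auxLine_im, auxLine_im, Real.log_exp, Real.log_exp,
    Real.dist_eq]

lemma aux_reflect (a : ℍ) (t l : ℝ)
    (h : 0 < (Real.exp l ^ 2 - (a.re ^ 2 + a.im ^ 2)) * (Real.exp t ^ 2 - Real.exp l ^ 2)) :
    dist a (auxLine (2 * l - t)) < dist a (auxLine t) := by
  have : Real.cosh (dist a (auxLine (2 * l - t))) < Real.cosh (dist a (auxLine t)) := by
    have hT : Real.exp (2 * l - t) = Real.exp l ^ 2 / Real.exp t := by
      rw [Real.exp_sub, two_mul, Real.exp_add, sq]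
    rw [cosh_dist', cosh_dist', auxLine_re, auxLine_re, auxLine_im, auxLine_im, hT]
    have ha := a.im_pos
    have hL := Real.exp_pos l
    have ht := Real.exp_pos t
    set L := Real.exp l
    set T := Real.exp t
    rw [div_lt_div_iff₀ (by positivity) (by positivity), ← sub_pos]
    have : ((a.re - 0) ^ 2 + a.im ^ 2 + T ^ 2) * (2 * a.im * (L ^ 2 / T)) - ((a.re - 0) ^ 2 + a.im ^ 2 + (L ^ 2 / T) ^ 2) * (2 * a.im * T) = ((L ^ 2 - (a.re ^ 2 + a.im ^ 2)) * (T ^ 2 - L ^ 2)) * (2 * a.im / T) := by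
      field_simp
      ring
    rw [this]
    positivity
  rw [Real.cosh_lt_cosh, abs_of_nonneg dist_nonneg, abs_of_nonneg dist_nonneg] at this
  exact this

lemma aux_between (a b : ℍ) (t T : ℝ)
    (ha1 : a.re ^ 2 + a.im ^ 2 < Real.exp T ^ 2) (hb1 : b.re ^ 2 + b.im ^ 2 < Real.exp T ^ 2)
    (ha2 : Real.exp (-T) ^ 2 < a.re ^ 2 + a.im ^ 2) (hb2 : Real.exp (-T) ^ 2 < b.re ^ 2 + b.im ^ 2)
    (h : dist a (auxLine t) + dist (auxLine t) b = dist a b) : |t| ≤ T := by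
  rw [abs_le]
  rw [dist_comm _ b] at h
  constructor
  · by_contra! hlt
    have hh : Real.exp t ^ 2 < Real.exp (-T) ^ 2 :=
      pow_lt_pow_left₀ (Real.exp_lt_exp.2 hlt) (Real.exp_pos _).le (by norm_num)
    have h1 := aux_reflect a t (-T) (mul_pos_of_neg_of_neg (by linarith) (by linarith))
    have h2 := aux_reflect b t (-T) (mul_pos_of_neg_of_neg (by linarith) (by linarith))
    have h3 := dist_triangle_right a b (auxLine (2 * -T - t))
    linarith
  · by_contra! hlt
    have hh : Real.exp T ^ 2 < Real.exp t ^ 2 :=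
      pow_lt_pow_left₀ (Real.exp_lt_exp.2 hlt) (Real.exp_pos _).le (by norm_num)
    have h1 := aux_reflect a t T (mul_pos (by linarith) (by linarith))
    have h2 := aux_reflect b t T (mul_pos (by linarith) (by linarith))
    have h3 := dist_triangle_right a b (auxLine (2 * T - t))
    linarith

lemma aux_cell_bound (m : ℍ) (r u : ℝ) (hr : 0 < r) (hr8 : r ≤ 1 / 8)
    (hm : dist m (auxLine u) ≤ 2 * r) :
    |m.re| ≤ 4 * r * Real.exp u ∧ |m.im - Real.exp u| ≤ 4 * r * Real.exp u := by
  have h1 := dist_coe_le m (auxLine u)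
  rw [auxLine_im] at h1
  have h2 : Real.exp (dist m (auxLine u)) - 1 ≤ 4 * r := by
    have h3 := Real.abs_exp_sub_one_le (x := 2 * r) (by rw [abs_of_pos (by positivity)]; linarith)
    rw [abs_of_pos (a := 2 * r) (by positivity)] at h3
    have h4 := le_abs_self (Real.exp (2 * r) - 1)
    have h5 := Real.exp_le_exp.2 hm
    linarith
  have h3 : dist (m : ℂ) (auxLine u) ≤ 4 * r * Real.exp u := by
    have := mul_le_mul_of_nonneg_left h2 (Real.exp_pos u).le
    linarith
  rw [Complex.dist_eq] at h3
  have h4 := Complex.abs_re_le_norm ((m : ℂ) - auxLine u)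
  have h5 := Complex.abs_im_le_norm ((m : ℂ) - auxLine u)
  simp only [Complex.sub_re, Complex.sub_im, coe_re, coe_im, auxLine_re, auxLine_im, sub_zero] at h4 h5
  exact ⟨h4.trans h3, h5.trans h3⟩

lemma aux_cell_close (m m' : ℍ) (r u : ℝ) (hr : 0 < r) (hr8 : r ≤ 1 / 8)
    (hm : dist m (auxLine u) ≤ 2 * r) (hm' : dist m' (auxLine u) ≤ 2 * r)
    (h1 : |m.re - m'.re| ≤ r / 8 * Real.exp u) (h2 : |m.im - m'.im| ≤ r / 8 * Real.exp u) :
    dist m m' ≤ r / 2 := by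
  have hE := Real.exp_pos u
  have a1 := (abs_le.1 (aux_cell_bound m r u hr hr8 hm).2).1
  have a2 := (abs_le.1 (aux_cell_bound m' r u hr hr8 hm').2).1
  have hrE : r * Real.exp u ≤ 1 / 8 * Real.exp u := mul_le_mul_of_nonneg_right hr8 hE.le
  have b1 : Real.exp u / 2 ≤ m.im := by linarith
  have b2 : Real.exp u / 2 ≤ m'.im := by linarith
  have hs : Real.exp u / 2 ≤ √(m.im * m'.im) := by
    apply Real.le_sqrt_of_sq_le
    rw [sq]
    exact mul_le_mul b1 b2 (by positivity) (by positivity)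
  have hd : dist (m : ℂ) m' ≤ r / 4 * Real.exp u := by
    rw [Complex.dist_eq]
    have := Complex.norm_le_abs_re_add_abs_im ((m : ℂ) - m')
    simp only [Complex.sub_re, Complex.sub_im, coe_re, coe_im] at this
    linarith
  refine (dist_le_dist_coe_div_sqrt m m').trans ?_
  rw [div_le_iff₀ (lt_of_lt_of_le (by positivity) hs)]
  have := mul_le_mul_of_nonneg_left hs (show 0 ≤ r / 2 by positivity)
  linarith

lemma aux_floor_close {x y c : ℝ} (hc : 0 < c) (h : ⌊x / c⌋ = ⌊y / c⌋) : |x - y| ≤ c := by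
  have := Int.abs_sub_lt_one_of_floor_eq_floor h
  rw [← sub_div, abs_div, abs_of_pos hc, div_lt_one hc] at this
  exact this.le

lemma aux_floor_mem {x c b : ℝ} {M : ℤ} (hc : 0 < c) (h : |x| ≤ b) (hb : b = M * c) :
    ⌊x / c⌋ ∈ Finset.Icc (-M) M := by
  rw [Finset.mem_Icc]
  have := abs_le.1 h
  constructor
  · rw [Int.le_floor, le_div_iff₀ hc]; push_cast; linarith
  · have : ⌊x / c⌋ ≤ ⌊(M : ℝ)⌋ := Int.floor_le_floor (by rw [div_le_iff₀ hc]; linarith)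
    simpa using this

lemma aux_crossing {ι : Type*} [Finite ι] (a b : ι → ℍ) (r T : ℝ) (hr : 0 < r) (hr8 : r ≤ 1 / 8)
    (hT : 0 ≤ T)
    (hab : ∀ k, 2 * r ≤ dist (a k) (b k))
    (hopt : ∀ k l, k ≠ l →
      dist (a k) (b k) + dist (a l) (b l) ≤ dist (a k) (a l) + dist (b k) (b l))
    (hcross : ∀ k t, dist (a k) (auxLine t) + dist (auxLine t) (b k) = dist (a k) (b k) → |t| ≤ T) :
    ({k | ∃ t, dist (a k) (auxLine t) + dist (auxLine t) (b k) = dist (a k) (b k)}.ncard : ℝ) ≤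
      8450 * (2 * T / r + 2) := by
  classical
  set S := {k | ∃ t, dist (a k) (auxLine t) + dist (auxLine t) (b k) = dist (a k) (b k)} with hS
  have hdata : ∀ k ∈ S, ∃ (t : ℝ) (f : Bool) (m : ℍ),
      dist (a k) (auxLine t) + dist (auxLine t) (b k) = dist (a k) (b k) ∧
      dist (auxLine t) m = r ∧
      dist m (if f then a k else b k) = dist (auxLine t) (if f then a k else b k) - r := by
    rintro k ⟨t, ht⟩
    by_cases h : r ≤ dist (auxLine t) (a k)
    · obtain ⟨m, h1, h2⟩ := aux_mid _ _ r hr h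
      exact ⟨t, true, m, ht, h1, by simpa using h2⟩
    · have h' : r ≤ dist (auxLine t) (b k) := by
        have := hab k
        rw [dist_comm (a k)] at ht
        linarith
      obtain ⟨m, h1, h2⟩ := aux_mid _ _ r hr h'
      exact ⟨t, false, m, ht, h1, by simpa using h2⟩
  choose! t f m h1 h2 h3 using hdata
  let u : ι → ℝ := fun k => ⌊t k / r⌋ * r
  have hu : ∀ k, 0 ≤ t k - u k ∧ t k - u k ≤ r := by
    intro k
    have e1 := Int.floor_le (t k / r)
    have e2 := (Int.lt_floor_add_one (t k / r)).le
    rw [le_div_iff₀ hr] at e1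
    rw [div_le_iff₀ hr] at e2
    simp only [u]
    constructor <;> linarith
  have hmu : ∀ k ∈ S, dist (m k) (auxLine (u k)) ≤ 2 * r := by
    intro k hk
    have e1 := dist_triangle (m k) (auxLine (t k)) (auxLine (u k))
    rw [auxLine_dist, abs_of_nonneg (hu k).1, dist_comm, dist_comm (m k), h2 k hk] at e1
    have := (hu k).2
    rw [dist_comm]
    linarith
  let F : ι → Bool × ℤ × ℤ × ℤ := fun k =>
    (f k, ⌊t k / r⌋, ⌊(m k).re / (r / 8 * Real.exp (u k))⌋,
      ⌊((m k).im - Real.exp (u k)) / (r / 8 * Real.exp (u k))⌋)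
  let G : Finset (Bool × ℤ × ℤ × ℤ) := Finset.univ ×ˢ Finset.Icc ⌊-T / r⌋ ⌊T / r⌋ ×ˢ
    Finset.Icc (-32) 32 ×ˢ Finset.Icc (-32) 32
  have hFG : ∀ k ∈ S, F k ∈ (G : Set _) := by
    intro k hk
    have hE := Real.exp_pos (u k)
    have hc := aux_cell_bound (m k) r (u k) hr hr8 (hmu k hk)
    have ht := abs_le.1 (hcross k (t k) (h1 k hk))
    simp only [F, G, Finset.mem_coe, Finset.mem_product, Finset.mem_univ, true_and]
    refine ⟨?_, aux_floor_mem (by positivity) hc.1 (by push_cast; ring),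
      aux_floor_mem (by positivity) hc.2 (by push_cast; ring)⟩
    rw [Finset.mem_Icc]
    exact ⟨Int.floor_le_floor (by gcongr; exact ht.1), Int.floor_le_floor (by gcongr; exact ht.2)⟩
  have hinj : Set.InjOn F S := by
    intro k hk l hl hF
    by_contra hne
    simp only [F, Prod.mk.injEq] at hF
    obtain ⟨g1, g2, g3, g4⟩ := hF
    have huu : u k = u l := by simp only [u]; rw [g2]
    rw [← huu] at g3 g4
    have hE := Real.exp_pos (u k)
    have c1 := aux_floor_close (by positivity) g3
    have c2 := aux_floor_close (by positivity) g4
    rw [sub_sub_sub_cancel_right] at c2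
    have c3 := aux_cell_close (m k) (m l) r (u k) hr hr8 (hmu k hk) (by rw [huu]; exact hmu l hl) c1 c2
    have c4 : dist (auxLine (t k)) (auxLine (t l)) ≤ r := by
      rw [auxLine_dist]; exact aux_floor_close hr g2
    have c5 := hopt k l hne
    have p1 := h1 k hk
    have p2 := h1 l hl
    have p3 := h3 k hk
    have p4 := h3 l hl
    rw [← g1] at p4
    cases hf : f k
    · simp only [hf, Bool.false_eq_true, if_false] at p3 p4
      have q1 := dist_triangle4 (a k) (auxLine (t k)) (auxLine (t l)) (a l)
      have q2 := dist_triangle4 (b k) (m k) (m l) (b l)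
      rw [dist_comm (b k) (m k)] at q2
      rw [dist_comm (auxLine (t l)) (a l)] at q1
      linarith
    · simp only [hf, if_true] at p3 p4
      have q1 := dist_triangle4 (b k) (auxLine (t k)) (auxLine (t l)) (b l)
      have q2 := dist_triangle4 (a k) (m k) (m l) (a l)
      rw [dist_comm (a k) (m k)] at q2
      rw [dist_comm (b k) (auxLine (t k))] at q1
      rw [dist_comm (a k) (auxLine (t k))] at p1
      rw [dist_comm (a l) (auxLine (t l))] at p2
      linarith
  have hcard : S.ncard ≤ G.card := by
    rw [← Set.ncard_coe_finset]
    exact Set.ncard_le_ncard_of_injOn F hFG hinj (Finset.finite_toSet G)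
  have hG : G.card = 2 * ((⌊T / r⌋ + 1 - ⌊-T / r⌋).toNat * (65 * 65)) := by
    simp only [G, Finset.card_product, Int.card_Icc, Finset.card_univ, Fintype.card_bool]
    rfl
  have hz : ((⌊T / r⌋ + 1 - ⌊-T / r⌋).toNat : ℝ) ≤ 2 * T / r + 2 := by
    have e1 := Int.floor_le (T / r)
    have e2 := Int.lt_floor_add_one (-T / r)
    have e0 : ⌊-T / r⌋ ≤ ⌊T / r⌋ := Int.floor_le_floor (by gcongr; linarith)
    have e3 : (((⌊T / r⌋ + 1 - ⌊-T / r⌋).toNat : ℤ) : ℝ) = ((⌊T / r⌋ + 1 - ⌊-T / r⌋ : ℤ) : ℝ) := by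
      rw [Int.toNat_of_nonneg (by omega)]
    rw [Int.cast_natCast] at e3
    rw [e3]
    push_cast
    have e4 : -T / r = - (T / r) := neg_div _ _
    have e5 : 2 * T / r = 2 * (T / r) := mul_div_assoc _ _ _
    rw [e5]
    rw [e4] at e2 ⊢
    linarith
  have : (S.ncard : ℝ) ≤ (G.card : ℝ) := by exact_mod_cast hcard
  rw [hG] at this
  push_cast at this
  linarith

lemma aux_center (n : ℕ) (hn : 3 ≤ n) (P : Finset ℍ) (hP : P.card = n) :
    ∃ z : ℍ, ∀ A B C : ℝ, A * (z.re ^ 2 + z.im ^ 2) + B * z.re + C = 0 →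
      3 * ({p ∈ P | 0 < A * (p.re ^ 2 + p.im ^ 2) + B * p.re + C}).card ≤ 2 * n := by
  classical
  let φ : ℍ → ℝ × ℝ := fun z => (z.re, z.re ^ 2 + z.im ^ 2)
  let s : Finset (Finset ℍ) := P.powerset.filter (fun S => 2 * n < 3 * S.card)
  let F : Finset ℍ → Set (ℝ × ℝ) := fun S => convexHull ℝ (φ '' (S : Set ℍ))
  have hne : (⋂ S ∈ s, F S).Nonempty := by
    apply Convex.helly_theorem' (𝕜 := ℝ)
    · intro S _
      exact convex_convexHull ℝ _
    · intro I hI hcard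
      have hfr : Module.finrank ℝ (ℝ × ℝ) = 2 := by simp
      rw [hfr] at hcard
      have hb : (I.biUnion (fun S => P \ S)).card ≤ ∑ S ∈ I, (P \ S).card := Finset.card_biUnion_le
      have hsm : ∀ S ∈ I, 3 * (P \ S).card ≤ n - 1 := by
        intro S hS
        have := hI hS
        simp only [s, Finset.mem_filter, Finset.mem_powerset] at this
        have e := Finset.card_sdiff_add_card_eq_card this.1
        omega
      have h3 : 3 * ∑ S ∈ I, (P \ S).card ≤ I.card * (n - 1) := by
        rw [Finset.mul_sum]
        simpa using Finset.sum_le_card_nsmul I _ _ hsm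
      have h4 : I.card * (n - 1) ≤ 3 * (n - 1) := Nat.mul_le_mul_right _ hcard
      have h5 : (I.biUnion (fun S => P \ S)).card < P.card := by omega
      obtain ⟨p, hp, hp'⟩ := Finset.exists_mem_notMem_of_card_lt_card h5
      refine ⟨φ p, ?_⟩
      simp only [Set.mem_iInter]
      intro S hS
      apply subset_convexHull
      refine ⟨p, ?_, rfl⟩
      by_contra hpS
      exact hp' (Finset.mem_biUnion.2 ⟨S, hS, Finset.mem_sdiff.2 ⟨hp, hpS⟩⟩)
  obtain ⟨c, hc⟩ := hne
  simp only [Set.mem_iInter] at hc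
  have hcP : c.1 ^ 2 < c.2 := by
    have h1 := hc P (by simp [s]; omega)
    have hconv : Convex ℝ {p : ℝ × ℝ | p.1 ∈ Set.univ ∧ p.1 ^ 2 < p.2} :=
      ConvexOn.convex_strict_epigraph (f := fun x : ℝ => x ^ 2) (Even.convexOn_pow (by decide : Even 2))
    have h2 : F P ⊆ {p : ℝ × ℝ | p.1 ∈ Set.univ ∧ p.1 ^ 2 < p.2} := by
      apply convexHull_min _ hconv
      rintro _ ⟨p, _, rfl⟩
      have := p.im_pos
      simp only [φ, Set.mem_ofPred_eq, Set.mem_univ, true_and]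
      nlinarith
    exact (h2 h1).2
  refine ⟨⟨⟨c.1, √(c.2 - c.1 ^ 2)⟩, Real.sqrt_pos.2 (by linarith)⟩, ?_⟩
  intro A B C h0
  have e1 : (⟨⟨c.1, √(c.2 - c.1 ^ 2)⟩, Real.sqrt_pos.2 (by linarith)⟩ : ℍ).re = c.1 := rfl
  have e2 : (⟨⟨c.1, √(c.2 - c.1 ^ 2)⟩, Real.sqrt_pos.2 (by linarith)⟩ : ℍ).im = √(c.2 - c.1 ^ 2) := rfl
  rw [e1, e2, Real.sq_sqrt (by linarith)] at h0
  by_contra! hlt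
  have h1 := hc _ (show {p ∈ P | 0 < A * (p.re ^ 2 + p.im ^ 2) + B * p.re + C} ∈ s by
    simp only [s, Finset.mem_filter, Finset.mem_powerset]
    exact ⟨Finset.filter_subset _ _, hlt⟩)
  have hconv : Convex ℝ {p : ℝ × ℝ | 0 < A * p.2 + B * p.1 + C} := by
    intro x hx y hy a b ha hb hab
    simp only [Set.mem_ofPred_eq, Prod.fst_add, Prod.snd_add, Prod.smul_fst, Prod.smul_snd, smul_eq_mul] at *
    have : A * (a * x.2 + b * y.2) + B * (a * x.1 + b * y.1) + C =
        a * (A * x.2 + B * x.1 + C) + b * (A * y.2 + B * y.1 + C) := by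
      linear_combination - C * hab
    rw [this]
    rcases ha.eq_or_lt with rfl | ha
    · have : b = 1 := by linarith
      subst this; linarith
    · have := mul_pos ha hx
      have := mul_nonneg hb hy.le
      linarith
  have h2 := convexHull_min (s := φ '' ((({p ∈ P | 0 < A * (p.re ^ 2 + p.im ^ 2) + B * p.re + C} : Finset ℍ)) : Set ℍ)) (by
    rintro _ ⟨p, hp, rfl⟩
    simp only [Finset.coe_filter, Set.mem_ofPred_eq] at hp
    exact hp.2) hconv h1
  simp only [Set.mem_ofPred_eq] at h2
  linarith

lemma aux_smul (g : Matrix.SpecialLinearGroup (Fin 2) ℝ) (z : ℍ) :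
    ∃ q : ℝ, 0 < q ∧ q = (g 1 0) ^ 2 * (z.re ^ 2 + z.im ^ 2) + 2 * g 1 0 * g 1 1 * z.re + (g 1 1) ^ 2 ∧
      (g • z).re * q = g 0 0 * g 1 0 * (z.re ^ 2 + z.im ^ 2) +
        (g 0 0 * g 1 1 + g 0 1 * g 1 0) * z.re + g 0 1 * g 1 1 ∧
      ((g • z).re ^ 2 + (g • z).im ^ 2) * q =
        (g 0 0) ^ 2 * (z.re ^ 2 + z.im ^ 2) + 2 * g 0 0 * g 0 1 * z.re + (g 0 1) ^ 2 := by
  have hdet : g 0 0 * g 1 1 - g 0 1 * g 1 0 = 1 := by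
    have := g.det_coe
    rwa [Matrix.det_fin_two] at this
  have h := coe_specialLinearGroup_apply g z
  have hz := z.im_pos
  set a := g 0 0
  set b := g 0 1
  set c := g 1 0
  set d := g 1 1
  simp only [Algebra.algebraMap_self, RingHom.id_apply] at h
  have hq : 0 < c ^ 2 * (z.re ^ 2 + z.im ^ 2) + 2 * c * d * z.re + d ^ 2 := by
    have : c ^ 2 * (z.re ^ 2 + z.im ^ 2) + 2 * c * d * z.re + d ^ 2 = (c * z.re + d) ^ 2 + (c * z.im) ^ 2 := by ring
    rw [this]
    by_cases hc : c = 0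
    · have hd : d ≠ 0 := by rintro h0; rw [hc, h0] at hdet; simp at hdet
      rw [hc]; simp; positivity
    · positivity
  have hden : ((c : ℂ) * z + d) ≠ 0 := by
    intro h0
    have h1 := congrArg Complex.re h0
    have h2 := congrArg Complex.im h0
    simp at h1 h2
    rcases h2 with h2 | h2
    · rw [h2] at h1 hdet; simp at h1; rw [h1] at hdet; simp at hdet
    · linarith
  rw [eq_div_iff hden] at h
  have h1 := congrArg Complex.re h
  have h2 := congrArg Complex.im h
  simp at h1 h2
  set X := (g • z).re
  set Y := (g • z).im
  refine ⟨_, hq, rfl, ?_, ?_⟩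
  · linear_combination (c * z.re + d) * h1 + (c * z.im) * h2
  · linear_combination (X * (c * z.re + d) - Y * c * z.im + (a * z.re + b)) * h1 +
      (X * c * z.im + Y * (c * z.re + d) + a * z.im) * h2

lemma aux_pigeon (n : ℕ) (hn : 1 ≤ n) (Q : Finset ℍ) (hQ : Q.card = n) (X D : ℍ → ℝ) :
    ∃ τ : ℝ, ∀ p ∈ Q, |(1 - τ ^ 2) * D p + 2 * τ * X p| ≤ 8 * (n : ℝ) * |(1 - τ ^ 2) * X p - 2 * τ * D p| := by
  have hn0 : (0 : ℝ) < n := by exact_mod_cast hn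
  by_contra! hcon
  let T : ℕ → ℝ := fun j => j / (2 * n)
  choose f hf1 hf2 using fun j : ℕ => hcon (T j)
  have : ∃ i ∈ Finset.range (n + 1), ∃ j ∈ Finset.range (n + 1), i ≠ j ∧ f i = f j :=
    Finset.exists_ne_map_eq_of_card_lt_of_maps_to (t := Q) (by simp [hQ]) (fun i _ => hf1 i)
  obtain ⟨i, hi, j, hj, hij, hfe⟩ := this
  wlog hlt : i < j generalizing i j
  · exact this j hj i hi hij.symm hfe.symm (by omega)
  have b1 := hf2 i
  have b2 := hf2 j
  rw [← hfe] at b2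
  have hT : ∀ i ∈ Finset.range (n + 1), 0 ≤ T i ∧ T i ≤ 1 / 2 := by
    intro i hi
    have : (i : ℝ) ≤ n := by exact_mod_cast Nat.lt_succ_iff.1 (Finset.mem_range.1 hi)
    refine ⟨by positivity, ?_⟩
    simp only [T]
    rw [div_le_iff₀ (by positivity)]
    linarith
  have hgap : 1 ≤ 2 * n * (T j - T i) := by
    have : (i : ℝ) + 1 ≤ j := by exact_mod_cast hlt
    simp only [T]
    field_simp
    linarith
  obtain ⟨s0, s1⟩ := hT i hi
  obtain ⟨t0, t1⟩ := hT j hj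
  set s := T i
  set t := T j
  set x := X (f i)
  set d := D (f i)
  have aux : ∀ u : ℝ, 0 ≤ u → u ≤ 1 / 2 → 8 * (n : ℝ) * |(1 - u ^ 2) * x - 2 * u * d| < |(1 - u ^ 2) * d + 2 * u * x| →
      8 * (n : ℝ) * |(1 - u ^ 2) * x - 2 * u * d| < |x| + |d| := by
    intro u hu0 hu1 h
    refine h.trans_le ((abs_add_le _ _).trans ?_)
    rw [abs_mul, abs_mul, abs_of_nonneg (show 0 ≤ 1 - u ^ 2 by nlinarith), abs_of_nonneg (show 0 ≤ 2 * u by linarith)]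
    nlinarith [abs_nonneg x, abs_nonneg d, mul_nonneg (sq_nonneg u) (abs_nonneg d), mul_nonneg (show 0 ≤ 1 - 2 * u by linarith) (abs_nonneg x)]
  have c1 := aux s s0 s1 b1
  have c2 := aux t t0 t1 b2
  set E := (1 - s ^ 2) * x - 2 * s * d with hE
  set E' := (1 - t ^ 2) * x - 2 * t * d with hE'
  have hD1 : d * (2 * (t - s) * (1 + s * t)) = (1 - t ^ 2) * E - (1 - s ^ 2) * E' := by rw [hE, hE']; ring
  have hX1 : x * (2 * (t - s) * (1 + s * t)) = 2 * t * E - 2 * s * E' := by rw [hE, hE']; ring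
  have hts : 0 < t - s := by
    by_contra! h
    have := mul_nonneg hn0.le (sub_nonneg.2 h)
    nlinarith
  have hst : 0 ≤ s * t := mul_nonneg s0 t0
  have hK : 2 * (t - s) ≤ 2 * (t - s) * (1 + s * t) := by nlinarith [mul_nonneg hts.le hst]
  have hD2 : |d| * (2 * (t - s)) ≤ |E| + |E'| := by
    have e1 : |d| * (2 * (t - s) * (1 + s * t)) ≤ |E| + |E'| := by
      rw [← abs_of_pos (show 0 < 2 * (t - s) * (1 + s * t) by positivity), ← abs_mul, hD1]
      refine (abs_sub _ _).trans ?_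
      rw [abs_mul, abs_mul, abs_of_nonneg (show 0 ≤ 1 - s ^ 2 by nlinarith), abs_of_nonneg (show 0 ≤ 1 - t ^ 2 by nlinarith)]
      nlinarith [mul_nonneg (sq_nonneg s) (abs_nonneg E'), mul_nonneg (sq_nonneg t) (abs_nonneg E)]
    exact (mul_le_mul_of_nonneg_left hK (abs_nonneg _)).trans e1
  have hX2 : |x| * (2 * (t - s)) ≤ |E| + |E'| := by
    have e1 : |x| * (2 * (t - s) * (1 + s * t)) ≤ |E| + |E'| := by
      rw [← abs_of_pos (show 0 < 2 * (t - s) * (1 + s * t) by positivity), ← abs_mul, hX1]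
      refine (abs_sub _ _).trans ?_
      rw [abs_mul (2 * t), abs_mul (2 * s), abs_of_nonneg (show 0 ≤ 2 * s by linarith), abs_of_nonneg (show 0 ≤ 2 * t by linarith)]
      nlinarith [mul_nonneg (show 0 ≤ 1 - 2 * s by linarith) (abs_nonneg E'), mul_nonneg (show 0 ≤ 1 - 2 * t by linarith) (abs_nonneg E)]
    exact (mul_le_mul_of_nonneg_left hK (abs_nonneg _)).trans e1
  have k1 := mul_le_mul_of_nonneg_left hD2 hn0.le
  have k2 := mul_le_mul_of_nonneg_left hX2 hn0.le
  have k3 := mul_le_mul_of_nonneg_left hgap (abs_nonneg x)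
  have k4 := mul_le_mul_of_nonneg_left hgap (abs_nonneg d)
  linarith [abs_nonneg x, abs_nonneg d]

lemma aux_rot (n : ℕ) (hn : 1 ≤ n) (τ : ℝ) : ∃ g : Matrix.SpecialLinearGroup (Fin 2) ℝ,
    (g • UpperHalfPlane.I = UpperHalfPlane.I) ∧
    ∀ p : ℍ, |(1 - τ ^ 2) * ((p.re ^ 2 + p.im ^ 2 - 1) / 2) + 2 * τ * p.re| ≤
        8 * (n : ℝ) * |(1 - τ ^ 2) * p.re - 2 * τ * ((p.re ^ 2 + p.im ^ 2 - 1) / 2)| →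
      (g • p).re ^ 2 + (g • p).im ^ 2 < (16 * n + 1) ^ 2 ∧
      1 < ((g • p).re ^ 2 + (g • p).im ^ 2) * (16 * n + 1) ^ 2 := by
  have hn0 : (1 : ℝ) ≤ n := by exact_mod_cast hn
  have hpos : 0 < 1 + τ ^ 2 := by positivity
  set k := 1 / √(1 + τ ^ 2) with hk
  have hk2 : k ^ 2 * (1 + τ ^ 2) = 1 := by
    rw [hk, div_pow, Real.sq_sqrt hpos.le]; field_simp
  have hk0 : 0 < k ^ 2 := by positivity
  let g : Matrix.SpecialLinearGroup (Fin 2) ℝ := ⟨!![k, k * τ; -(k * τ), k], by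
    rw [Matrix.det_fin_two_of]; linear_combination hk2⟩
  have g00 : g 0 0 = k := rfl
  have g01 : g 0 1 = k * τ := rfl
  have g10 : g 1 0 = -(k * τ) := rfl
  have g11 : g 1 1 = k := rfl
  refine ⟨g, ?_, ?_⟩
  · obtain ⟨q, hq, hqe, h1, h2⟩ := aux_smul g UpperHalfPlane.I
    rw [g10, g11] at hqe
    rw [g00, g01, g10, g11] at h1
    rw [g00, g01] at h2
    simp only [UpperHalfPlane.I_re, UpperHalfPlane.I_im] at hqe h1 h2
    have e1 : q = 1 := by rw [hqe]; linear_combination hk2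
    rw [e1] at h1 h2
    have e2 : (g • UpperHalfPlane.I).re = 0 := by linarith
    have e3 : (g • UpperHalfPlane.I).im ^ 2 = 1 := by rw [e2] at h2; linear_combination h2 + hk2
    have e4 : (g • UpperHalfPlane.I).im = 1 := by
      have := (g • UpperHalfPlane.I).im_pos
      nlinarith
    apply UpperHalfPlane.ext_re_im
    · rw [e2, UpperHalfPlane.I_re]
    · rw [e4, UpperHalfPlane.I_im]
  · intro p hp
    obtain ⟨q, hq, hqe, h1, h2⟩ := aux_smul g p
    rw [g10, g11] at hqe
    rw [g00, g01, g10, g11] at h1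
    rw [g00, g01] at h2
    have hY := (g • p).im_pos
    set x := (g • p).re
    set y := (g • p).im
    set N := p.re ^ 2 + p.im ^ 2
    have e1 : (1 - τ ^ 2) * p.re - 2 * τ * ((N - 1) / 2) = x * (q / k ^ 2) := by
      rw [← mul_div_assoc _ q, eq_div_iff hk0.ne', h1]; ring
    have e2 : (1 - τ ^ 2) * ((N - 1) / 2) + 2 * τ * p.re = ((x ^ 2 + y ^ 2 - 1) / 2) * (q / k ^ 2) := by
      have : ((x ^ 2 + y ^ 2 - 1) / 2) * q = ((x ^ 2 + y ^ 2) * q - q) / 2 := by ring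
      rw [← mul_div_assoc _ q, eq_div_iff hk0.ne', this, h2, hqe]; ring
    have hqk : 0 < q / k ^ 2 := by positivity
    rw [e1, e2, abs_mul, abs_mul, abs_of_pos hqk, ← mul_assoc] at hp
    have hp := le_of_mul_le_mul_right hp hqk
    rw [abs_div, abs_two] at hp
    set M := x ^ 2 + y ^ 2
    have hM : 0 < M := by positivity
    set s := √M
    have hs : 0 < s := Real.sqrt_pos.2 hM
    have hsM : s ^ 2 = M := Real.sq_sqrt hM.le
    have hxs : |x| ≤ s := Real.abs_le_sqrt (by simp only [M]; nlinarith)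
    rw [← hsM] at hp ⊢
    have hp2 : |s ^ 2 - 1| ≤ 16 * n * s := by
      have := mul_le_mul_of_nonneg_left hxs (show (0 : ℝ) ≤ 16 * n by positivity)
      linarith
    obtain ⟨u1, u2⟩ := abs_le.1 hp2
    constructor
    · apply pow_lt_pow_left₀ _ hs.le (by norm_num)
      by_contra! h
      nlinarith
    · rw [← mul_pow]
      apply one_lt_pow₀ _ (by norm_num)
      by_contra! h
      have h5 : s * 1 ≤ s * s := by linarith
      have h6 : 1 ≤ s := le_of_mul_le_mul_left h5 hs
      have h7 : 1 * (16 * (n : ℝ) + 1) ≤ s * (16 * n + 1) :=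
        mul_le_mul_of_nonneg_right h6 (by positivity)
      linarith


theorem exists_separator_line_few_tour_crossings :
    ∃ C : ℝ, 0 < C ∧
      ∀ α : ℝ, 0 < α →
      ∀ n : ℕ, ∀ hn : 3 ≤ n,
      ∀ P : Finset ℍ, P.card = n →
      (∀ p ∈ P, ∀ p' ∈ P, p ≠ p' → α ≤ dist p p') →
      ∃ γ : ℝ → ℍ,
        (∀ s t : ℝ, dist (γ s) (γ t) = |s - t|) ∧
        (∀ z : ℍ, z ∉ Set.range γ →
          (((↑P : Set ℍ) ∩ connectedComponentIn (Set.range γ)ᶜ z).ncard : ℝ) ≤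
            2 / 3 * n) ∧
        (∀ x : Fin n → ℍ, Function.Injective x → Set.range x = (↑P : Set ℍ) →
          (∀ σ : Equiv.Perm (Fin n),
            ∑ k : Fin n, dist (x k) (x (k + ⟨1, by omega⟩)) ≤
              ∑ k : Fin n, dist (x (σ k)) (x (σ (k + ⟨1, by omega⟩)))) →
          ({k : Fin n | ∃ z ∈ Set.range γ,
              dist (x k) z + dist z (x (k + ⟨1, by omega⟩)) =
                dist (x k) (x (k + ⟨1, by omega⟩))}.ncard : ℝ) ≤
            C * max 1 (1 / α) * Real.log n) := by
  refine ⟨8450 * 66, by norm_num, ?_⟩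
  intro α hα n hn P hP hsp
  have hn0 : (3 : ℝ) ≤ n := by exact_mod_cast hn
  obtain ⟨z0, hz0⟩ := aux_center n hn P hP
  set h0 := z0.toSL2R⁻¹ with hh0
  have hI0 : h0 • z0 = UpperHalfPlane.I := by
    rw [hh0, inv_smul_eq_iff, toSL2R_smul_I]
  obtain ⟨τ, hτ⟩ := aux_pigeon n (by omega) P hP (fun p => (h0 • p).re)
    (fun p => ((h0 • p).re ^ 2 + (h0 • p).im ^ 2 - 1) / 2)
  obtain ⟨g, hgI, hg⟩ := aux_rot n (by omega) τ
  set h := g * h0 with hh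
  have hI : h • z0 = UpperHalfPlane.I := by rw [hh, mul_smul, hI0, hgI]
  have hN : ∀ p ∈ P, (h • p).re ^ 2 + (h • p).im ^ 2 < (16 * n + 1) ^ 2 ∧
      1 < ((h • p).re ^ 2 + (h • p).im ^ 2) * (16 * n + 1) ^ 2 := by
    intro p hp
    rw [hh, mul_smul]
    exact hg _ (hτ p hp)
  have hcont : Continuous (fun p : ℍ => (h • p).re) :=
    UpperHalfPlane.continuous_re.comp (isometry_smul ℍ h).continuous
  have hzero : h 0 0 * h 1 0 * (z0.re ^ 2 + z0.im ^ 2) +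
      (h 0 0 * h 1 1 + h 0 1 * h 1 0) * z0.re + h 0 1 * h 1 1 = 0 := by
    obtain ⟨q, hq, _, h1, _⟩ := aux_smul h z0
    rw [hI, UpperHalfPlane.I_re] at h1
    linarith
  refine ⟨fun t => h⁻¹ • auxLine t, ?_, ?_, ?_⟩
  · intro s t
    rw [dist_smul, auxLine_dist]
  · intro z hz
    set K := connectedComponentIn (Set.range fun t => h⁻¹ • auxLine t)ᶜ z with hK
    have hzK : z ∈ K := mem_connectedComponentIn hz
    have hnz : ∀ p ∈ K, (h • p).re ≠ 0 := by
      intro p hp h0'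
      apply connectedComponentIn_subset _ _ hp
      refine ⟨Real.log (h • p).im, ?_⟩
      rw [inv_smul_eq_iff]
      apply UpperHalfPlane.ext_re_im
      · rw [auxLine_re, h0']
      · rw [auxLine_im, Real.exp_log (h • p).im_pos]
    have hpre : IsPreconnected K := isPreconnected_connectedComponentIn
    have hside : (∀ p ∈ K, 0 < (h • p).re) ∨ (∀ p ∈ K, (h • p).re < 0) := by
      by_contra! hcon
      obtain ⟨⟨p, hp, hp'⟩, q, hq, hq'⟩ := hcon
      obtain ⟨w, hw, hw'⟩ := hpre.intermediate_value hp hq hcont.continuousOn ⟨hp', hq'⟩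
      exact hnz w hw hw'
    have hfin : ∀ A B C : ℝ, A * (z0.re ^ 2 + z0.im ^ 2) + B * z0.re + C = 0 →
        (∀ p ∈ K, 0 < A * (p.re ^ 2 + p.im ^ 2) + B * p.re + C) →
        (((P : Set ℍ) ∩ K).ncard : ℝ) ≤ 2 / 3 * n := by
      intro A B C h1 h2
      have h3 := hz0 A B C h1
      have h4 : ((P : Set ℍ) ∩ K).ncard ≤
          ({p ∈ P | 0 < A * (p.re ^ 2 + p.im ^ 2) + B * p.re + C} : Finset ℍ).card := by
        rw [← Set.ncard_coe_finset]
        apply Set.ncard_le_ncard _ (Finset.finite_toSet _)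
        rintro p ⟨hp, hpK⟩
        simp only [Finset.coe_filter, Set.mem_ofPred_eq]
        exact ⟨hp, h2 p hpK⟩
      have h5 : 3 * ((P : Set ℍ) ∩ K).ncard ≤ 2 * n := by omega
      have h6 : 3 * (((P : Set ℍ) ∩ K).ncard : ℝ) ≤ 2 * n := by exact_mod_cast h5
      linarith
    rcases hside with hs | hs
    · refine hfin _ _ _ hzero ?_
      intro p hp
      obtain ⟨q, hq, _, h1, _⟩ := aux_smul h p
      rw [← h1]
      exact mul_pos (hs p hp) hq
    · refine hfin (-(h 0 0 * h 1 0)) (-(h 0 0 * h 1 1 + h 0 1 * h 1 0)) (-(h 0 1 * h 1 1))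
        (by linarith) ?_
      intro p hp
      obtain ⟨q, hq, _, h1, _⟩ := aux_smul h p
      have := mul_neg_of_neg_of_pos (hs p hp) hq
      linarith
  · intro x hxi hxr hopt
    have hxP : ∀ k, x k ∈ P := by
      intro k
      have : x k ∈ Set.range x := ⟨k, rfl⟩
      rw [hxr] at this
      exact this
    have hset : {k : Fin n | ∃ z ∈ Set.range (fun t => h⁻¹ • auxLine t),
        dist (x k) z + dist z (x (k + ⟨1, by omega⟩)) = dist (x k) (x (k + ⟨1, by omega⟩))} =
        {k : Fin n | ∃ t, dist (h • x k) (auxLine t) + dist (auxLine t) (h • x (k + ⟨1, by omega⟩)) =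
          dist (h • x k) (h • x (k + ⟨1, by omega⟩))} := by
      ext k
      simp only [Set.mem_ofPred_eq, Set.exists_range_iff]
      refine exists_congr fun t => ?_
      rw [dist_smul h (x k) (x _), ← dist_smul h (x k) (h⁻¹ • auxLine t),
        ← dist_smul h (h⁻¹ • auxLine t) (x _), smul_inv_smul]
    rw [hset]
    have hR : (0 : ℝ) < 16 * n + 1 := by positivity
    set T := Real.log (16 * n + 1) with hT
    have hT0 : 0 ≤ T := Real.log_nonneg (by linarith)
    have hET : Real.exp T = 16 * n + 1 := Real.exp_log hR
    set r := min 1 α / 8 with hr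
    have hm0 : 0 < min 1 α := lt_min one_pos hα
    have hr0 : 0 < r := by positivity
    have hr8 : r ≤ 1 / 8 := by
      have := min_le_left 1 α
      linarith
    have hne : ∀ k : Fin n, k ≠ k + ⟨1, by omega⟩ := by
      intro k hk
      have h1 := congrArg Fin.val hk
      rw [Fin.val_add] at h1
      have h2 := k.isLt
      rcases Nat.lt_or_ge (k.val + 1) n with h3 | h3
      · rw [Nat.mod_eq_of_lt h3] at h1; omega
      · have h4 : k.val + 1 = n := by omega
        simp only [h4, Nat.mod_self] at h1
        omega
    have hb1 : ∀ k, (h • x k).re ^ 2 + (h • x k).im ^ 2 < Real.exp T ^ 2 := by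
      intro k; rw [hET]; exact (hN _ (hxP k)).1
    have hb2 : ∀ k, Real.exp (-T) ^ 2 < (h • x k).re ^ 2 + (h • x k).im ^ 2 := by
      intro k
      rw [Real.exp_neg, hET, inv_pow, inv_lt_iff_one_lt_mul₀ (by positivity)]
      have := (hN _ (hxP k)).2
      linarith
    have hD := aux_two_opt (fun i j => dist (x i) (x j)) (fun i j => dist_comm _ _)
      ⟨1, by omega⟩ rfl hopt
    have key := aux_crossing (fun k => h • x k) (fun k => h • x (k + ⟨1, by omega⟩)) r T hr0 hr8 hT0
      (by
        intro k
        simp only [dist_smul]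
        have h1 := hsp _ (hxP k) _ (hxP (k + ⟨1, by omega⟩)) (fun he => hne k (hxi he))
        have := min_le_right 1 α
        linarith)
      (by
        intro k l hkl
        simp only [dist_smul]
        rcases lt_or_gt_of_ne hkl with h1 | h1
        · exact hD k l h1
        · have := hD l k h1
          simp only [dist_comm (x l) (x k), dist_comm (x (l + ⟨1, by omega⟩)) (x (k + ⟨1, by omega⟩))] at this
          linarith)
      (by
        intro k t ht
        exact aux_between _ _ t T (hb1 _) (hb1 _) (hb2 _) (hb2 _) ht)
    refine key.trans ?_
    have hL : 1 ≤ Real.log n := by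
      rw [Real.le_log_iff_exp_le (by linarith)]
      linarith [Real.exp_one_lt_d9]
    have hTL : T ≤ 4 * Real.log n := by
      have : 4 * Real.log n = Real.log ((n : ℝ) ^ 4) := by rw [Real.log_pow]; norm_num
      rw [this]
      apply Real.log_le_log hR
      have h3 : (27 : ℝ) ≤ (n : ℝ) ^ 3 := by
        have := pow_le_pow_left₀ (by norm_num) hn0 3
        norm_num at this
        exact this
      nlinarith
    have hmu : 1 / r = 8 * max 1 (1 / α) := by
      rw [hr]
      rcases le_total 1 α with h1 | h1
      · rw [min_eq_left h1, max_eq_left (by rw [div_le_one hα]; exact h1)]; norm_num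
      · rw [min_eq_right h1, max_eq_right (by rw [le_div_iff₀ hα]; linarith)]
        field_simp
    set μ := max 1 (1 / α) with hmu'
    have hμ : 1 ≤ μ := le_max_left _ _
    have e1 : 2 * T / r = 16 * μ * T := by
      rw [div_eq_mul_one_div, hmu]; ring
    rw [e1]
    have e2 : μ * T ≤ μ * (4 * Real.log n) := mul_le_mul_of_nonneg_left hTL (by linarith)
    have e3 : 1 ≤ μ * Real.log n := one_le_mul_of_one_le_of_one_le hμ hL
    nlinarith
end

section
/- For every finite set P of n ≥ 1 points in the hyperbolic plane ℍ there exist a point q ∈ ℍ and an isometric embedding γ : ℝ → ℍ with q ∈ Set.range γ such that: (a) for every p ∈ P, Real.sinh (Metric.infDist p (Set.range γ)) ≥ Real.sin (π / (2 * n)) * Real.sinh (dist p q); and (b) every connected component of the complement of Set.range γ in ℍ contains at most (2/3)·n points of P. -/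
open Real UpperHalfPlane

lemma aux_angles (n : ℕ) (hn : 1 ≤ n) (B : Finset ℝ) (hB : B.card ≤ n) :
    ∃ φ : ℝ, ∀ β ∈ B, Real.sin (π / (2 * n)) ≤ |Real.sin (β - φ)| := by
  have hn0 : (0:ℝ) < n := by exact_mod_cast hn
  have hn1 : (1:ℝ) ≤ n := by exact_mod_cast hn
  rcases B.eq_empty_or_nonempty with rfl | ⟨b0, hb0⟩
  · exact ⟨0, by simp⟩
  set A : Set ℝ := {x | ∃ β ∈ B, ∃ k : ℤ, x = β + k * π} with hA
  have hstep : ∃ a ∈ A, ∀ x ∈ A, ¬ (a < x ∧ x < a + π / n) := by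
    by_contra! hcon
    choose! f hfA hf1 hf2 using hcon
    have hb0A : b0 ∈ A := ⟨b0, hb0, 0, by simp⟩
    set a : ℕ → ℝ := fun k => f^[k] b0 with ha
    have hsucc : ∀ k, a (k+1) = f (a k) := fun k => by
      simp only [ha, Function.iterate_succ_apply']
    have haA : ∀ k, a k ∈ A := by
      intro k
      induction k with
      | zero => exact hb0A
      | succ k ih => rw [hsucc]; exact hfA _ ih
    have hmono : StrictMono a := strictMono_nat_of_lt_succ (fun k => by
      rw [hsucc]; exact hf1 _ (haA k))
    have hlt : ∀ k, a (k+1) < b0 + (k+1) * (π / n) := by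
      intro k
      induction k with
      | zero => rw [hsucc]; have := hf2 _ (haA 0); simpa [ha] using this
      | succ k ih => rw [hsucc]; have := hf2 _ (haA (k+1)); push_cast; linarith
    have hmem : ∀ k ∈ Finset.range (n+1), a k ∈ B.image (fun β => toIcoMod pi_pos b0 β) := by
      intro k hk
      obtain ⟨β, hβ, m, hm⟩ := haA k
      rw [Finset.mem_image]
      refine ⟨β, hβ, ?_⟩
      rw [toIcoMod_eq_iff]
      refine ⟨⟨hmono.monotone (Nat.zero_le k), ?_⟩, -m, by rw [hm]; simp⟩
      have h1 : a k ≤ a n := hmono.monotone (by simpa [Nat.lt_succ_iff] using hk)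
      obtain ⟨j, rfl⟩ : ∃ j, n = j + 1 := ⟨n - 1, by omega⟩
      have h2 := hlt j
      have : ((j:ℝ)+1) * (π / ((j+1 : ℕ):ℝ)) = π := by
        push_cast; field_simp
      linarith
    have := Finset.card_le_card_of_injOn a hmem hmono.injective.injOn
    have h2 : (B.image (fun β => toIcoMod pi_pos b0 β)).card ≤ B.card := Finset.card_image_le
    simp at this
    omega
  obtain ⟨a, haA, ha⟩ := hstep
  set δ := π / (2 * n) with hδ
  have hδ2 : π / n = 2 * δ := by rw [hδ]; field_simp
  have hδ0 : 0 < δ := by positivity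
  have hδ1 : δ ≤ π / 2 := by
    rw [hδ]; apply div_le_div_of_nonneg_left pi_pos.le (by norm_num); linarith
  refine ⟨a + δ, fun β hβ => ?_⟩
  have hx := toIcoMod_mem_Ico pi_pos a β
  obtain ⟨k, hk⟩ : ∃ k : ℤ, β = toIcoMod pi_pos a β + k * π :=
    ⟨toIcoDiv pi_pos a β, by simpa using (toIcoMod_add_toIcoDiv_zsmul pi_pos a β).symm⟩
  set x := toIcoMod pi_pos a β
  have hxA : x ∈ A := ⟨β, hβ, -k, by rw [hk]; push_cast; ring⟩
  have h1 := ha x hxA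
  have habs : |Real.sin (β - (a + δ))| = |Real.sin (x - (a + δ))| := by
    rw [hk, show x + k * π - (a + δ) = (x - (a+δ)) + k * π by ring, Real.sin_add_int_mul_pi]
    rcases Int.even_or_odd k with h | h
    · simp [h.neg_one_zpow]
    · simp [h.neg_one_zpow]
  rw [habs]
  rcases eq_or_lt_of_le hx.1 with h | h
  · rw [← h, show a - (a + δ) = -δ by ring, Real.sin_neg, abs_neg]; exact le_abs_self _
  · have h3 : a + π / n ≤ x := by by_contra! h4; exact h1 ⟨h, h4⟩
    have h4 := hx.2
    apply le_trans _ (le_abs_self _)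
    rcases le_total (x - (a+δ)) (π/2) with h5 | h5
    · apply Real.sin_le_sin_of_le_of_le_pi_div_two <;> linarith
    · rw [← Real.sin_pi_sub (x - (a+δ))]
      apply Real.sin_le_sin_of_le_of_le_pi_div_two <;> linarith

noncomputable def auxX (q p : ℍ) : ℝ := (p.re - q.re) / p.im
noncomputable def auxY (q p : ℍ) : ℝ :=
  ((p.re - q.re)^2 + p.im^2 - q.im^2) / (2 * q.im * p.im)

lemma aux_sinh (q p : ℍ) : Real.sinh (dist p q) ^ 2 = auxX q p ^ 2 + auxY q p ^ 2 := by
  have h := Real.cosh_sq (dist p q)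
  rw [UpperHalfPlane.cosh_dist'] at h
  have h1 := p.im_ne_zero
  have h2 := q.im_ne_zero
  have : Real.sinh (dist p q) ^ 2 = (((p.re - q.re) ^ 2 + p.im ^ 2 + q.im ^ 2) / (2 * p.im * q.im))^2 - 1 := by
    linarith
  rw [this, auxX, auxY]
  field_simp
  ring

lemma aux_iso (q : ℍ) (φ : ℝ) : ∃ e : ℍ ≃ᵢ ℍ, e q = I ∧
    ∀ p, (e p).re / (e p).im = Real.cos φ * auxX q p + Real.sin φ * auxY q p := by
  set c := Real.cos (φ/2) with hc
  set s := Real.sin (φ/2) with hs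
  have hcs : s^2 + c^2 = 1 := Real.sin_sq_add_cos_sq _
  have hC : Real.cos φ = c^2 - s^2 := by
    rw [show φ = 2 * (φ/2) by ring, Real.cos_two_mul']
  have hS : Real.sin φ = 2 * s * c := by
    rw [show φ = 2 * (φ/2) by ring, Real.sin_two_mul]
  let k : Matrix.SpecialLinearGroup (Fin 2) ℝ := ⟨!![c, -s; s, c], by
    rw [Matrix.det_fin_two_of]; linarith⟩
  let a : {x : ℝ // 0 < x} := ⟨q.im⁻¹, inv_pos.2 q.im_pos⟩
  let e : ℍ ≃ᵢ ℍ := IsometryEquiv.mk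
    (((AddAction.toPerm (-q.re) : Equiv.Perm ℍ).trans (MulAction.toPerm a)).trans (MulAction.toPerm k))
    (((isometry_smul ℍ k).comp (isometry_pos_mul a)).comp (isometry_real_vadd (-q.re)))
  have he : ∀ p, e p = k • (a • ((-q.re) +ᵥ p)) := fun p => rfl
  refine ⟨e, ?_, ?_⟩
  · rw [he]
    have : a • ((-q.re) +ᵥ q) = I := by
      apply UpperHalfPlane.ext_re_im
      · simp
      · simp [a, q.im_ne_zero]
    rw [this]
    apply UpperHalfPlane.ext
    rw [coe_specialLinearGroup_apply]
    have hd : ((s:ℂ) * Complex.I + c) ≠ 0 := by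
      intro h
      have h1 := congrArg Complex.re h
      have h2 := congrArg Complex.im h
      simp at h1 h2
      rw [h1, h2] at hcs; simp at hcs
    simp only [k, Matrix.SpecialLinearGroup.coe_mk]
    simp
    rw [div_eq_iff hd]
    apply Complex.ext <;> simp
  · intro p
    rw [he]
    set w := a • ((-q.re) +ᵥ p) with hw
    have hwr : w.re = (p.re - q.re) / q.im := by simp [hw, a]; ring
    have hwi : w.im = p.im / q.im := by simp [hw, a]; ring
    have hd : ((s * w.re + c)^2 + (s * w.im)^2) ≠ 0 := by
      intro h
      have h1 : s * w.im = 0 := by nlinarith [sq_nonneg (s * w.re + c), sq_nonneg (s * w.im)]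
      have h3 : s = 0 := by simpa [w.im_ne_zero] using h1
      rw [h3] at h hcs
      simp at h hcs
      simp [h] at hcs
    have hr : (k • w).re = ((c * w.re - s) * (s * w.re + c) + c * w.im * (s * w.im)) / ((s * w.re + c)^2 + (s * w.im)^2) := by
      rw [← UpperHalfPlane.coe_re, coe_specialLinearGroup_apply]
      simp only [k, Matrix.SpecialLinearGroup.coe_mk]
      simp [Complex.div_re, Complex.normSq_apply]
      field_simp
      ring
    have hi : (k • w).im = w.im / ((s * w.re + c)^2 + (s * w.im)^2) := by
      rw [← UpperHalfPlane.coe_im, coe_specialLinearGroup_apply]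
      simp only [k, Matrix.SpecialLinearGroup.coe_mk]
      simp [Complex.div_im, Complex.normSq_apply]
      rw [← sub_div]
      rw [div_eq_div_iff (by convert hd using 1; ring) hd]
      linear_combination (w.im * ((s * w.re + c)^2 + (s * w.im)^2)) * hcs
    rw [hr, hi, hC, hS, auxX, auxY, div_div_div_cancel_right₀ hd, hwr, hwi]
    have h1 := p.im_ne_zero
    have h2 := q.im_ne_zero
    field_simp
    ring


noncomputable def auxK (p : ℍ) : ℝ × ℝ := (p.re, p.re^2 + p.im^2)

lemma aux_center_s1 (n : ℕ) (hn : 1 ≤ n) (P : Finset ℍ) (hcard : P.card = n) :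
    ∃ q : ℍ, ∀ a b : ℝ, ∀ S ⊆ P, (∀ p ∈ S, 0 < a * auxX q p + b * auxY q p) →
      3 * S.card ≤ 2 * n := by
  classical
  have hH : (⋂ S ∈ P.powerset.filter (fun S => 2 * n < 3 * S.card),
      convexHull ℝ (auxK '' (S : Set ℍ))).Nonempty := by
    apply Convex.helly_theorem' (𝕜 := ℝ)
    · intro S _; exact convex_convexHull ℝ _
    · intro J hJ hJc
      have hfr : Module.finrank ℝ (ℝ × ℝ) = 2 := by simp
      rw [hfr] at hJc
      have hex : ∃ p ∈ P, ∀ S ∈ J, p ∈ S := by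
        by_contra! hcon
        have hsub : P ⊆ J.biUnion (fun S => P \ S) := by
          intro p hp
          obtain ⟨S, hS, hpS⟩ := hcon p hp
          simp only [Finset.mem_biUnion, Finset.mem_sdiff]
          exact ⟨S, hS, hp, hpS⟩
        have h1 := Finset.card_le_card hsub
        have h2 : (J.biUnion (fun S => P \ S)).card ≤ J.card * ((n - 1) / 3) := by
          apply Finset.card_biUnion_le_card_mul
          intro S hS
          have := hJ hS
          rw [Finset.mem_filter, Finset.mem_powerset] at this
          rw [Finset.card_sdiff_of_subset this.1]
          have := this.2
          omega
        have h3 : J.card * ((n - 1) / 3) ≤ 3 * ((n-1)/3) := Nat.mul_le_mul_right _ hJc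
        omega
      obtain ⟨p, hp, hpJ⟩ := hex
      refine ⟨auxK p, ?_⟩
      simp only [Set.mem_iInter]
      intro S hS
      exact subset_convexHull ℝ _ ⟨p, hpJ S hS, rfl⟩
  obtain ⟨c, hc⟩ := hH
  simp only [Set.mem_iInter, Finset.mem_filter, Finset.mem_powerset] at hc
  have hcP : c.1^2 < c.2 := by
    have h := hc P ⟨subset_rfl, by omega⟩
    have hconv : Convex ℝ {x : ℝ × ℝ | x.1^2 < x.2} := by
      have := (even_two.convexOn_pow (𝕜 := ℝ)).convex_strict_epigraph
      simpa using this
    have := convexHull_min (s := auxK '' (P : Set ℍ)) ?_ hconv h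
    · exact this
    · rintro _ ⟨p, _, rfl⟩
      have := p.im_pos
      simp only [auxK, Set.mem_ofPred_eq]
      nlinarith
  let q : ℍ := UpperHalfPlane.mk ⟨c.1, √(c.2 - c.1^2)⟩ (Real.sqrt_pos.2 (by linarith))
  have hqr : q.re = c.1 := rfl
  have hqi : q.im ^ 2 = c.2 - c.1^2 := Real.sq_sqrt (by linarith)
  refine ⟨q, fun a b S hS hpos => ?_⟩
  by_contra! hlt
  have h := hc S ⟨hS, hlt⟩
  have hq0 := q.im_pos
  let f : ℝ × ℝ →ₗ[ℝ] ℝ := (a - b * c.1 / q.im) • LinearMap.fst ℝ ℝ ℝ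
      + (b / (2 * q.im)) • LinearMap.snd ℝ ℝ ℝ
  have hf : ∀ x, f x = (a - b * c.1 / q.im) * x.1 + b / (2 * q.im) * x.2 := fun x => rfl
  have hconv : Convex ℝ {x | f c < f x} := convex_halfSpace_gt f.isLinear _
  have := convexHull_min (s := auxK '' (S : Set ℍ)) ?_ hconv h
  · rw [Set.mem_ofPred_eq] at this; exact lt_irrefl _ this
  · rintro _ ⟨p, hp, rfl⟩
    have h1 := mul_pos p.im_pos (hpos p hp)
    have h2 : f (auxK p) - f c = p.im * (a * auxX q p + b * auxY q p) := by
      rw [hf, hf, auxX, auxY, hqi, hqr]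
      have := p.im_ne_zero
      simp only [auxK]
      field_simp
      ring
    simp only [Set.mem_ofPred_eq]
    linarith

lemma aux_infDist (w : ℍ) (L : Set ℍ) (hL : L.Nonempty) (h : ∀ z ∈ L, z.re = 0) :
    |w.re / w.im| ≤ Real.sinh (Metric.infDist w L) := by
  rw [← Real.sinh_arsinh |w.re / w.im|, Real.sinh_le_sinh, Metric.le_infDist hL]
  intro z hz
  rw [← Real.sinh_le_sinh, Real.sinh_arsinh]
  have h1 := aux_sinh z w
  have h2 : auxX z w = w.re / w.im := by rw [auxX, h z hz, sub_zero]
  rw [h2] at h1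
  apply abs_le_of_sq_le_sq
  · nlinarith [sq_nonneg (auxY z w)]
  · exact Real.sinh_nonneg_iff.2 dist_nonneg

theorem exists_balanced_separator_line_with_empty_cone
    (n : ℕ) (hn : 1 ≤ n) (P : Finset ℍ) (hcard : P.card = n) :
    ∃ q : ℍ, ∃ γ : ℝ → ℍ,
      (∀ s t : ℝ, dist (γ s) (γ t) = |s - t|) ∧
      q ∈ Set.range γ ∧
      (∀ p ∈ P, Real.sin (π / (2 * n)) * Real.sinh (dist p q) ≤
        Real.sinh (Metric.infDist p (Set.range γ))) ∧
      (∀ z : ℍ, z ∉ Set.range γ →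
        (((↑P : Set ℍ) ∩ connectedComponentIn (Set.range γ)ᶜ z).ncard : ℝ) ≤
          2 / 3 * n) := by
  classical
  obtain ⟨q, hq⟩ := aux_center_s1 n hn P hcard
  obtain ⟨φ, hφ⟩ := aux_angles n hn
    (P.image (fun p => Complex.arg ⟨auxX q p, auxY q p⟩ + π / 2))
    (Finset.card_image_le.trans hcard.le)
  obtain ⟨e, heq, he⟩ := aux_iso q φ
  set ι : ℝ → ℍ := fun y => UpperHalfPlane.mk ⟨0, Real.exp y⟩ (Real.exp_pos y) with hι
  have hιiso : Isometry ι := isometry_vertical_line 0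
  set γ : ℝ → ℍ := fun t => e.symm (ι t) with hγ
  have hιre : ∀ t, (ι t).re = 0 := fun t => rfl
  have hrange : ∀ p : ℍ, p ∈ Set.range γ ↔ (e p).re / (e p).im = 0 := by
    intro p
    constructor
    · rintro ⟨t, rfl⟩
      simp [hγ, hιre]
    · intro h
      have h1 : (e p).re = 0 := by
        rcases div_eq_zero_iff.1 h with h | h
        · exact h
        · exact absurd h (e p).im_ne_zero
      refine ⟨Real.log (e p).im, ?_⟩
      simp only [hγ]
      rw [e.symm_apply_eq]
      apply UpperHalfPlane.ext_re_im
      · rw [h1, hιre]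
      · exact Real.exp_log (e p).im_pos
  refine ⟨q, γ, ?_, ?_, ?_, ?_⟩
  · intro s t
    simp only [hγ]
    rw [e.symm.dist_eq, hιiso.dist_eq, Real.dist_eq]
  · rw [hrange, heq]; simp
  · intro p hp
    have h1 := hφ _ (Finset.mem_image_of_mem _ hp)
    have hnorm : ‖(⟨auxX q p, auxY q p⟩ : ℂ)‖ = Real.sinh (dist p q) := by
      rw [Complex.norm_eq_sqrt_sq_add_sq]
      simp only
      rw [← aux_sinh, Real.sqrt_sq (Real.sinh_nonneg_iff.2 dist_nonneg)]
    set α := Complex.arg ⟨auxX q p, auxY q p⟩ with hα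
    have hX : auxX q p = Real.sinh (dist p q) * Real.cos α := by
      rw [← hnorm, hα, Complex.norm_mul_cos_arg]
    have hY : auxY q p = Real.sinh (dist p q) * Real.sin α := by
      rw [← hnorm, hα, Complex.norm_mul_sin_arg]
    rw [show α + π / 2 - φ = (α - φ) + π / 2 by ring, Real.sin_add_pi_div_two] at h1
    have h2 : (e p).re / (e p).im = Real.sinh (dist p q) * Real.cos (α - φ) := by
      rw [he, hX, hY, Real.cos_sub]; ring
    have h3 : Metric.infDist p (Set.range γ) = Metric.infDist (e p) (Set.range ι) := by
      rw [← Metric.infDist_image e.isometry, ← Set.range_comp]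
      congr 2
      ext t
      simp [hγ]
    have h4 := aux_infDist (e p) (Set.range ι) (Set.range_nonempty _) (by
      rintro _ ⟨t, rfl⟩; exact hιre t)
    rw [h3]
    refine le_trans ?_ h4
    have h0 : 0 ≤ Real.sinh (dist p q) := Real.sinh_nonneg_iff.2 dist_nonneg
    rw [h2, abs_mul, abs_of_nonneg h0, mul_comm]
    exact mul_le_mul_of_nonneg_left h1 h0
  · intro z hz
    have hcont : Continuous (fun p : ℍ => (e p).re / (e p).im) := by
      apply Continuous.div
      · exact UpperHalfPlane.continuous_re.comp e.continuous
      · exact UpperHalfPlane.continuous_im.comp e.continuous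
      · intro p; exact (e p).im_ne_zero
    set C := connectedComponentIn (Set.range γ)ᶜ z with hC
    have hCpre : IsPreconnected C := isPreconnected_connectedComponentIn
    have hCsub : C ⊆ (Set.range γ)ᶜ := connectedComponentIn_subset _ _
    have hne : ∀ p ∈ C, (e p).re / (e p).im ≠ 0 := fun p hp h => hCsub hp ((hrange p).2 h)
    have hsign : (∀ p ∈ C, 0 < (e p).re / (e p).im) ∨ (∀ p ∈ C, (e p).re / (e p).im < 0) := by
      by_contra! hcon
      obtain ⟨⟨p1, hp1, h1⟩, p2, hp2, h2⟩ := hcon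
      obtain ⟨p, hp, h⟩ := hCpre.intermediate_value hp1 hp2 hcont.continuousOn ⟨h1, h2⟩
      exact hne p hp h
    have hkey : 3 * (P.filter (· ∈ C)).card ≤ 2 * n := by
      rcases hsign with h | h
      · apply hq (Real.cos φ) (Real.sin φ) _ (Finset.filter_subset _ _)
        intro p hp
        rw [← he]; exact h p (Finset.mem_filter.1 hp).2
      · apply hq (-Real.cos φ) (-Real.sin φ) _ (Finset.filter_subset _ _)
        intro p hp
        have := h p (Finset.mem_filter.1 hp).2
        rw [he] at this; linarith
    have hset : (↑P : Set ℍ) ∩ C = ↑(P.filter (· ∈ C)) := by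
      ext p; simp
    rw [hset, Set.ncard_coe_finset]
    have : (3:ℝ) * ((P.filter (· ∈ C)).card : ℝ) ≤ 2 * n := by exact_mod_cast hkey
    linarith
end

section
/- Let X be a metric space, let α > 0 and 0 ≤ ρ < α/2, let L ≥ 0, and let γ : ℝ → X be an isometric embedding (dist (γ s) (γ t) = |s - t| for all s, t). Let S be a finite α-spaced subset of X such that for every p ∈ S there exists t_p ∈ Set.Icc (0:ℝ) L with dist p (γ t_p) ≤ ρ. Then (S.card : ℝ) ≤ 1 + L / (α - 2*ρ). -/
theorem spaced_points_near_geodesic_segment_card_le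
    {X : Type*} [MetricSpace X] {α ρ L : ℝ}
    (hα : 0 < α) (hρ0 : 0 ≤ ρ) (hρ : ρ < α / 2) (hL : 0 ≤ L)
    (γ : ℝ → X) (hγ : ∀ s t : ℝ, dist (γ s) (γ t) = |s - t|)
    (S : Finset X)
    (hspaced : ∀ p ∈ S, ∀ p' ∈ S, p ≠ p' → α ≤ dist p p')
    (hnear : ∀ p ∈ S, ∃ t ∈ Set.Icc (0 : ℝ) L, dist p (γ t) ≤ ρ) :
    (S.card : ℝ) ≤ 1 + L / (α - 2 * ρ) := by
  have hd : 0 < α - 2 * ρ := by linarith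
  choose! t ht htd using hnear
  have hcard : S.card ≤ (Finset.range (⌊L / (α - 2 * ρ)⌋₊ + 1)).card := by
    apply Finset.card_le_card_of_injOn (fun p => ⌊t p / (α - 2 * ρ)⌋₊)
    · intro p hp
      have hp : p ∈ S := hp
      have h1 : ⌊t p / (α - 2 * ρ)⌋₊ ≤ ⌊L / (α - 2 * ρ)⌋₊ :=
        Nat.floor_le_floor (div_le_div_of_nonneg_right (ht p hp).2 hd.le)
      simp only [Finset.coe_range, Set.mem_Iio]
      omega
    · intro p hp q hq hpq
      have hp : p ∈ S := hp
      have hq : q ∈ S := hq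
      have hpq : ⌊t p / (α - 2 * ρ)⌋₊ = ⌊t q / (α - 2 * ρ)⌋₊ := hpq
      by_contra hne
      have h1 := hspaced p hp q hq hne
      have h2 := dist_triangle4 p (γ (t p)) (γ (t q)) q
      have h3 := htd p hp
      have h4 := htd q hq
      rw [dist_comm q] at h4
      rw [hγ] at h2
      have a1 := Nat.floor_le (div_nonneg (ht p hp).1 hd.le)
      have a2 := Nat.lt_floor_add_one (t p / (α - 2 * ρ))
      have b1 := Nat.floor_le (div_nonneg (ht q hq).1 hd.le)
      have b2 := Nat.lt_floor_add_one (t q / (α - 2 * ρ))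
      rw [hpq] at a1 a2
      have h5 : |t p / (α - 2 * ρ) - t q / (α - 2 * ρ)| < 1 := by
        rw [abs_lt]; constructor <;> linarith
      rw [← sub_div, abs_div, abs_of_pos hd, div_lt_one hd] at h5
      linarith
  rw [Finset.card_range] at hcard
  have h1 : (S.card : ℝ) ≤ (⌊L / (α - 2 * ρ)⌋₊ : ℝ) + 1 := by exact_mod_cast hcard
  have h2 := Nat.floor_le (div_nonneg hL hd.le)
  linarith
end

section
/- Let X be a metric space, n ≥ 3, and let x : Fin n → X be an injective optimal tour. Let i, j ∈ Fin n be such that i, i+1, j, j+1 are four distinct indices (addition mod n). Suppose a, a', b, b' ∈ X satisfy dist (x i) a + dist a a' + dist a' (x (i+1)) = dist (x i) (x (i+1)) and dist (x j) b + dist b b' + dist b' (x (j+1)) = dist (x j) (x (j+1)). Then dist a a' + dist b b' ≤ dist a b + dist a' b'. -/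
theorem tour_sum_aux {X : Type*} [MetricSpace X] {N : ℕ} (h : Fin (N + 1) → X) (w : ℕ → X)
    (hw : ∀ k : Fin (N + 1), h k = w k.val) :
    ∑ k : Fin (N + 1), dist (h k) (h (k + 1)) =
      ∑ k ∈ Finset.range N, dist (w k) (w (k + 1)) + dist (w N) (w 0) := by
  rw [Fin.sum_univ_castSucc, Finset.sum_range]
  congr 1
  · apply Finset.sum_congr rfl
    intro k _
    rw [hw, hw, Fin.coeSucc_eq_succ]
    simp
  · rw [hw, hw, Fin.last_add_one]
    simp

theorem two_opt_aux {X : Type*} [MetricSpace X] (w : ℕ → X) (m p : ℕ) (t : ℕ → ℕ)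
    (ht : ∀ k, t k = if k ≤ m then m - k else k) :
    ∑ k ∈ Finset.range (m + 1 + p), dist (w (t k)) (w (t (k + 1))) + dist (w m) (w (m + 1)) =
      ∑ k ∈ Finset.range (m + 1 + p), dist (w k) (w (k + 1)) + dist (w 0) (w (m + 1)) := by
  rw [Finset.sum_range_add _ (m + 1) p, Finset.sum_range_add _ (m + 1) p,
    Finset.sum_range_succ _ m, Finset.sum_range_succ _ m]
  have h1 : ∑ k ∈ Finset.range m, dist (w (t k)) (w (t (k + 1))) =
      ∑ k ∈ Finset.range m, dist (w k) (w (k + 1)) := by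
    rw [← Finset.sum_range_reflect]
    apply Finset.sum_congr rfl
    intro k hk
    rw [Finset.mem_range] at hk
    have e1 : t (m - 1 - k) = k + 1 := by rw [ht, if_pos (by omega)]; omega
    have e2 : t (m - 1 - k + 1) = k := by rw [ht, if_pos (by omega)]; omega
    rw [e1, e2, dist_comm]
  have h2 : ∑ k ∈ Finset.range p, dist (w (t (m + 1 + k))) (w (t (m + 1 + k + 1))) =
      ∑ k ∈ Finset.range p, dist (w (m + 1 + k)) (w (m + 1 + k + 1)) := by
    apply Finset.sum_congr rfl
    intro k hk
    rw [ht, ht, if_neg (by omega), if_neg (by omega)]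
  have e3 : t m = 0 := by rw [ht]; simp
  have e4 : t (m + 1) = m + 1 := by rw [ht]; simp
  rw [h1, h2, e3, e4]
  ring

theorem optimal_tour_rerouting
    {X : Type*} [MetricSpace X] {n : ℕ} [NeZero n] (hn : 3 ≤ n)
    (x : Fin n → X) (hinj : Function.Injective x)
    (hopt : ∀ σ : Equiv.Perm (Fin n),
      ∑ k : Fin n, dist (x k) (x (k + 1)) ≤
        ∑ k : Fin n, dist (x (σ k)) (x (σ (k + 1))))
    (i j : Fin n)
    (hdistinct : ({i, i + 1, j, j + 1} : Finset (Fin n)).card = 4)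
    (a a' b b' : X)
    (ha : dist (x i) a + dist a a' + dist a' (x (i + 1)) = dist (x i) (x (i + 1)))
    (hb : dist (x j) b + dist b b' + dist b' (x (j + 1)) = dist (x j) (x (j + 1))) :
    dist a a' + dist b b' ≤ dist a b + dist a' b' := by
  have hij : i ≠ j := by
    rintro rfl
    have h2 : ({i, i + 1, i, i + 1} : Finset (Fin n)) = {i, i + 1} := by
      ext; simp
    rw [h2] at hdistinct
    have := Finset.card_le_two (a := i) (b := i + 1)
    omega
  obtain ⟨N, rfl⟩ : ∃ N, n = N + 1 := ⟨n - 1, by omega⟩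
  obtain ⟨m, hm⟩ : ∃ m : Fin (N + 1), m = j - (i + 1) := ⟨_, rfl⟩
  have hj : m + (i + 1) = j := by rw [hm]; abel
  have hmN : m.val < N := by
    have h1 := m.isLt
    by_contra hlt
    have h2 : m = Fin.last N := Fin.ext (by simp; omega)
    apply hij
    rw [← hj, h2, add_comm i 1, ← add_assoc, Fin.last_add_one, zero_add]
  obtain ⟨p, hp⟩ : ∃ p, N = m.val + 1 + p := ⟨N - (m.val + 1), by omega⟩
  let t : ℕ → ℕ := fun k => if k ≤ m.val then m.val - k else k
  have ht : ∀ k, t k = if k ≤ m.val then m.val - k else k := fun _ => rfl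
  have htl : ∀ k, k < N + 1 → t k < N + 1 := by
    intro k hk; rw [ht]; split_ifs <;> omega
  have htt : ∀ k, t (t k) = k := by
    intro k; simp only [ht]; split_ifs <;> omega
  let T : Equiv.Perm (Fin (N + 1)) :=
    { toFun := fun k => ⟨t k.val, htl _ k.isLt⟩
      invFun := fun k => ⟨t k.val, htl _ k.isLt⟩
      left_inv := fun k => Fin.ext (htt _)
      right_inv := fun k => Fin.ext (htt _) }
  let w : ℕ → X := fun k => x (Fin.ofNat (N + 1) k + (i + 1))
  have hwf : ∀ k : Fin (N + 1), x (k + (i + 1)) = w k.val := by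
    intro k; simp [w]
  have s1 := hopt (T.trans (Equiv.addRight (i + 1)))
  have s2 := tour_sum_aux (fun k => x ((T.trans (Equiv.addRight (i + 1))) k)) (fun k => w (t k))
    (fun k => hwf (T k))
  have s3 := tour_sum_aux (fun k => x (k + (i + 1))) w hwf
  have s4 : ∑ k : Fin (N + 1), dist (x (k + (i + 1))) (x (k + 1 + (i + 1))) =
      ∑ k : Fin (N + 1), dist (x k) (x (k + 1)) := by
    rw [← Equiv.sum_comp (Equiv.addRight (i + 1)) (fun k => dist (x k) (x (k + 1)))]
    apply Finset.sum_congr rfl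
    intro k _
    simp only [Equiv.coe_addRight]
    rw [add_right_comm k 1]
  have s5 := two_opt_aux w m.val p t ht
  rw [← hp] at s5
  have w0 : w 0 = x (i + 1) := by
    have := hwf 0
    simpa using this.symm
  have wm : w m.val = x j := by rw [← hwf, hj]
  have wm1 : w (m.val + 1) = x (j + 1) := by
    have := hwf (m + 1)
    rw [Fin.val_add_one_of_lt (by rw [Fin.lt_def]; simpa using hmN)] at this
    rw [← this, ← hj, add_right_comm m 1]
  have wN : w N = x i := by
    have := hwf (Fin.last N)
    rw [add_comm i 1, ← add_assoc, Fin.last_add_one, zero_add] at this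
    simpa using this.symm
  have t0 : t 0 = m.val := by simp [ht]
  have tN : t N = N := by rw [ht, if_neg (by omega)]
  simp only [t0, tN] at s2
  rw [wN, wm] at s2
  rw [wN, w0] at s3
  rw [w0, wm, wm1] at s5
  have key : dist (x i) (x (i + 1)) + dist (x j) (x (j + 1)) ≤
      dist (x i) (x j) + dist (x (i + 1)) (x (j + 1)) := by
    linarith
  have q1 := dist_triangle4 (x i) a b (x j)
  have q2 := dist_triangle4 (x (i + 1)) a' b' (x (j + 1))
  rw [dist_comm b (x j)] at q1
  rw [dist_comm (x (i + 1)) a'] at q2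
  linarith
end

section
/- Let X be a metric space, n ≥ 3, and let x : Fin n → X be an injective optimal tour. Let i, j ∈ Fin n be such that i, i+1, j, j+1 are four distinct indices (addition mod n). Then dist (x i) (x (i+1)) + dist (x j) (x (j+1)) ≤ dist (x i) (x j) + dist (x (i+1)) (x (j+1)). -/
def revFun {n : ℕ} (a b : ℕ) (hb : b < n) (k : Fin n) : Fin n :=
  if h : a ≤ k.val ∧ k.val ≤ b then ⟨a + b - k.val, by omega⟩ else k

theorem revFun_val {n : ℕ} (a b : ℕ) (hb : b < n) (k : Fin n) :
    (revFun a b hb k).val = if a ≤ k.val ∧ k.val ≤ b then a + b - k.val else k.val := by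
  unfold revFun
  split_ifs <;> rfl

theorem revFun_invol {n : ℕ} (a b : ℕ) (hb : b < n) :
    Function.Involutive (revFun (n := n) a b hb) := by
  intro k
  apply Fin.ext
  rw [revFun_val, revFun_val]
  split_ifs <;> omega

theorem succ_val {n : ℕ} [NeZero n] (hn : 3 ≤ n) (k : Fin n) :
    (k + 1).val = if k.val + 1 = n then 0 else k.val + 1 := by
  have h1 : (1 : Fin n).val = 1 := by
    rw [Fin.val_one', Nat.mod_eq_of_lt (by omega)]
  rw [Fin.val_add, h1]
  have := k.isLt
  split_ifs with h
  · rw [h, Nat.mod_self]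
  · exact Nat.mod_eq_of_lt (by omega)

theorem two_opt_aux_s4
    {X : Type*} [MetricSpace X] {n : ℕ} [NeZero n] (hn : 3 ≤ n)
    (x : Fin n → X)
    (hopt : ∀ σ : Equiv.Perm (Fin n),
      ∑ k : Fin n, dist (x k) (x (k + 1)) ≤
        ∑ k : Fin n, dist (x (σ k)) (x (σ (k + 1))))
    (i j : Fin n) (hij : i.val < j.val) :
    dist (x i) (x (i + 1)) + dist (x j) (x (j + 1)) ≤
      dist (x i) (x j) + dist (x (i + 1)) (x (j + 1)) := by
  have hj := j.isLt
  have hjn : j.val - 1 < n := by omega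
  have h1 := hopt (revFun_invol (i.val + 1) j.val hj).toPerm
  simp only [Function.Involutive.coe_toPerm] at h1
  rw [← Equiv.sum_comp (revFun_invol (i.val + 1) (j.val - 1) hjn).toPerm] at h1
  simp only [Function.Involutive.coe_toPerm] at h1
  rw [← sub_nonneg, ← Finset.sum_sub_distrib,
    Finset.sum_eq_add i j (by intro h; rw [h] at hij; omega)] at h1
  · have e1 : revFun (i.val + 1) (j.val - 1) hjn i = i := by
      apply Fin.ext; rw [revFun_val]; split_ifs <;> omega
    have e2 : revFun (i.val + 1) (j.val - 1) hjn j = j := by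
      apply Fin.ext; rw [revFun_val]; split_ifs <;> omega
    have e3 : revFun (i.val + 1) j.val hj i = i := by
      apply Fin.ext; rw [revFun_val]; split_ifs <;> omega
    have e4 : revFun (i.val + 1) j.val hj (i + 1) = j := by
      apply Fin.ext; rw [revFun_val, succ_val hn]; split_ifs <;> omega
    have e5 : revFun (i.val + 1) j.val hj j = i + 1 := by
      apply Fin.ext; rw [revFun_val, succ_val hn]; split_ifs <;> omega
    have e6 : revFun (i.val + 1) j.val hj (j + 1) = j + 1 := by
      apply Fin.ext; rw [revFun_val, succ_val hn]; split_ifs <;> omega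
    rw [e1, e2, e3, e4, e5, e6] at h1
    linarith
  · intro k _ hk
    have hki : k.val ≠ i.val := fun h => hk.1 (Fin.ext h)
    have hkj : k.val ≠ j.val := fun h => hk.2 (Fin.ext h)
    have hkn := k.isLt
    rw [sub_eq_zero]
    by_cases hm : i.val < k.val ∧ k.val < j.val
    · have f1 : revFun (i.val + 1) j.val hj k
          = revFun (i.val + 1) (j.val - 1) hjn k + 1 := by
        apply Fin.ext; rw [succ_val hn, revFun_val, revFun_val]; split_ifs <;> omega
      have f2 : revFun (i.val + 1) j.val hj (k + 1)
          = revFun (i.val + 1) (j.val - 1) hjn k := by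
        apply Fin.ext; rw [revFun_val, revFun_val, succ_val hn]; split_ifs <;> omega
      rw [f1, f2, dist_comm]
    · have f0 : revFun (i.val + 1) (j.val - 1) hjn k = k := by
        apply Fin.ext; rw [revFun_val]; split_ifs <;> omega
      have f1 : revFun (i.val + 1) j.val hj k = k := by
        apply Fin.ext; rw [revFun_val]; split_ifs <;> omega
      have f2 : revFun (i.val + 1) j.val hj (k + 1) = k + 1 := by
        apply Fin.ext; rw [revFun_val, succ_val hn]; split_ifs <;> omega
      rw [f0, f1, f2]
  · intro h; exact absurd (Finset.mem_univ _) h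
  · intro h; exact absurd (Finset.mem_univ _) h

theorem optimal_tour_two_opt
    {X : Type*} [MetricSpace X] {n : ℕ} [NeZero n] (hn : 3 ≤ n)
    (x : Fin n → X) (hinj : Function.Injective x)
    (hopt : ∀ σ : Equiv.Perm (Fin n),
      ∑ k : Fin n, dist (x k) (x (k + 1)) ≤
        ∑ k : Fin n, dist (x (σ k)) (x (σ (k + 1))))
    (i j : Fin n)
    (hdistinct : ({i, i + 1, j, j + 1} : Finset (Fin n)).card = 4) :
    dist (x i) (x (i + 1)) + dist (x j) (x (j + 1)) ≤
      dist (x i) (x j) + dist (x (i + 1)) (x (j + 1)) := by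
  rcases lt_trichotomy i.val j.val with h | h | h
  · exact two_opt_aux_s4 hn x hopt i j h
  · exfalso
    have hij : i = j := Fin.ext h
    subst hij
    have h2 : ({i, i + 1, i, i + 1} : Finset (Fin n)) ⊆ {i, i + 1} := by
      intro a ha
      simp only [Finset.mem_insert, Finset.mem_singleton] at ha ⊢
      tauto
    have h3 := Finset.card_le_card h2
    have h4 := Finset.card_le_two (a := i) (b := i + 1)
    omega
  · have := two_opt_aux_s4 hn x hopt j i h
    rw [dist_comm (x j) (x i), dist_comm (x (j + 1)) (x (i + 1))] at this
    linarith
end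

section
/- Let n ≥ 3 and let x : Fin n → ℍ be an injective optimal tour of points in the hyperbolic plane. Let i, j ∈ Fin n be such that i, i+1, j, j+1 are four distinct indices (addition mod n), and suppose the four points x i, x (i+1), x j, x (j+1) do not all lie on one geodesic line (i.e. there is no isometric embedding γ : ℝ → ℍ whose range contains all four). Then there is no point z ∈ ℍ, distinct from x i, x (i+1), x j and x (j+1), that is metrically between x i and x (i+1) and also metrically between x j and x (j+1). -/
open UpperHalfPlane

/-- the 2-opt move -/
theorem two_opt {X : Type*} [MetricSpace X] {N : ℕ} (y : Fin (N+1) → X) (m : Fin (N+1))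
    (hm : m ≠ Fin.last N) :
    ∃ σ : Equiv.Perm (Fin (N+1)),
      ∑ k, dist (y (σ k)) (y (σ (k+1))) =
        ∑ k, dist (y k) (y (k+1)) - dist (y m) (y (m+1)) - dist (y (Fin.last N)) (y 0)
          + dist (y 0) (y (m+1)) + dist (y (Fin.last N)) (y m) := by
  have hmN : m.val < N := by
    have := m.is_lt
    have h2 : m.val ≠ N := fun h => hm (Fin.ext (by simpa using h))
    omega
  let s : Fin (N+1) → Fin (N+1) := fun k =>
    if k.val ≤ m.val then ⟨m.val - k.val, by omega⟩ else k
  let t : Fin (N+1) → Fin (N+1) := fun k =>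
    if k.val < m.val then ⟨m.val - 1 - k.val, by omega⟩ else k
  have hs : Function.Involutive s := by
    intro k
    apply Fin.ext
    simp only [s]
    split_ifs <;> simp_all <;> omega
  have ht : Function.Involutive t := by
    intro k
    apply Fin.ext
    simp only [t]
    split_ifs <;> simp_all <;> omega
  refine ⟨hs.toPerm, ?_⟩
  have e1 : ∑ k, dist (y k) (y (k+1)) = ∑ k, dist (y (t k)) (y (t k+1)) :=
    (Equiv.sum_comp ht.toPerm (fun k => dist (y k) (y (k+1)))).symm
  have val1 : ∀ k : Fin (N+1), k.val < N → (k+1).val = k.val + 1 := by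
    intro k hk
    rw [Fin.val_add_one, if_neg]
    intro h; rw [h] at hk; simp at hk
  have hlast : Fin.last N + 1 = 0 := Fin.last_add_one N
  have hval1 := val1 m hmN
  have s0 : s 0 = m := Fin.ext (by simp [s])
  have sm : s m = 0 := Fin.ext (by simp [s])
  have sm1 : s (m+1) = m+1 := by
    simp only [s]; rw [if_neg]; omega
  have sl : s (Fin.last N) = Fin.last N := by
    simp only [s]; rw [if_neg]; simp; omega
  have tm : t m = m := by simp [t]
  have tl : t (Fin.last N) = Fin.last N := by
    simp only [t]; rw [if_neg]; simp; omega
  have e2 : ∑ k, (dist (y (s k)) (y (s (k+1))) - dist (y (t k)) (y (t k+1))) =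
      (dist (y (s m)) (y (s (m+1))) - dist (y (t m)) (y (t m+1))) +
      (dist (y (s (Fin.last N))) (y (s (Fin.last N+1))) -
        dist (y (t (Fin.last N))) (y (t (Fin.last N)+1))) := by
    apply Fintype.sum_eq_add m (Fin.last N) hm
    rintro k ⟨hk1, hk2⟩
    have hkN : k.val < N := by
      have := k.is_lt
      have h2 : k.val ≠ N := fun h => hk2 (Fin.ext (by simpa using h))
      omega
    have hkm : k.val ≠ m.val := fun h => hk1 (Fin.ext h)
    have hk := val1 k hkN
    rcases lt_or_gt_of_ne hkm with h | h
    · have a1 : (t k).val = m.val - 1 - k.val := by simp only [t]; rw [if_pos h]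
      have a2 : s k = t k + 1 := by
        apply Fin.ext
        rw [val1 _ (by omega), a1]
        simp only [s]; rw [if_pos h.le]; simp only []; omega
      have a3 : s (k+1) = t k := by
        apply Fin.ext
        rw [a1]
        simp only [s]; rw [if_pos (by omega)]; simp only []; omega
      rw [a2, a3, dist_comm, sub_self]
    · have a1 : t k = k := by simp only [t]; rw [if_neg (by omega)]
      have a2 : s k = k := by simp only [s]; rw [if_neg (by omega)]
      have a3 : s (k+1) = k+1 := by simp only [s]; rw [if_neg (by omega)]
      rw [a1, a2, a3, sub_self]
  rw [Finset.sum_sub_distrib, ← e1, hlast, s0, sm, sm1, sl, tm, tl, hlast] at e2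
  simp only [Function.Involutive.coe_toPerm]
  linarith

theorem two_opt_ineq {n : ℕ} [NeZero n] (x : Fin n → ℍ)
    (hopt : ∀ σ : Equiv.Perm (Fin n),
      ∑ k : Fin n, dist (x k) (x (k + 1)) ≤
        ∑ k : Fin n, dist (x (σ k)) (x (σ (k + 1))))
    (i j : Fin n) (hij : i ≠ j) :
    dist (x i) (x (i+1)) + dist (x j) (x (j+1)) ≤
      dist (x i) (x j) + dist (x (i+1)) (x (j+1)) := by
  obtain ⟨N, rfl⟩ : ∃ N, n = N + 1 := ⟨n - 1, by have := NeZero.ne n; omega⟩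
  let r : Equiv.Perm (Fin (N+1)) := Equiv.addRight (i+1)
  have hlast : Fin.last N + 1 = 0 := Fin.last_add_one N
  have hl : Fin.last N + (i + 1) = i := by
    rw [add_comm i 1, ← add_assoc, hlast, zero_add]
  obtain ⟨σ, hσ⟩ := two_opt (fun k => x (r k)) (j - (i+1)) (by
    intro h
    apply hij
    rw [← hl, ← h]; simp)
  have h := hopt (σ.trans r |>.symm.symm)
  have h0 : ∑ k, dist (x (r k)) (x (r (k+1))) = ∑ k, dist (x k) (x (k+1)) := by
    rw [← Equiv.sum_comp r (fun k => dist (x k) (x (k+1)))]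
    refine Finset.sum_congr rfl fun k _ => ?_
    have : r (k+1) = r k + 1 := by simp only [r, Equiv.coe_addRight]; abel
    rw [this]
  simp only [Equiv.symm_symm, Equiv.trans_apply] at h
  have r1 : r (j - (i+1)) = j := sub_add_cancel j (i+1)
  have r2 : r (j - (i+1) + 1) = j + 1 := by simp only [r, Equiv.coe_addRight]; abel
  have r3 : r 0 = i + 1 := by simp [r]
  have r4 : r (Fin.last N) = i := hl
  simp only [h0, r1, r2, r3, r4] at hσ
  linarith

noncomputable def hU (z : ℍ) : ℝ := 1 / z.im
noncomputable def hW (z : ℍ) : ℝ := z.re / z.im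
noncomputable def hV (z : ℍ) : ℝ := (z.re ^ 2 + z.im ^ 2) / z.im

theorem hU_pos (z : ℍ) : 0 < hU z := by have := z.im_pos; unfold hU; positivity

theorem hUV (z : ℍ) : hU z * hV z = hW z ^ 2 + 1 := by
  have := z.im_pos.ne'
  unfold hU hV hW; field_simp

theorem cosh_hyp (z w : ℍ) :
    Real.cosh (dist z w) = (hU z * hV w + hU w * hV z) / 2 - hW z * hW w := by
  have := z.im_pos.ne'
  have := w.im_pos.ne'
  rw [UpperHalfPlane.cosh_dist']
  unfold hU hV hW; field_simp; ring

theorem hyp_ext (z w : ℍ) (h1 : hU z = hU w) (h2 : hW z = hW w) : z = w := by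
  have h := z.im_pos.ne'
  have h' := w.im_pos.ne'
  unfold hU at h1
  unfold hW at h2
  have e : z.im = w.im := by
    field_simp at h1
    exact h1.symm
  rw [e] at h2
  have e2 : z.re = w.re := by field_simp at h2; exact h2
  exact UpperHalfPlane.ext (Complex.ext e2 e)

theorem hyp_mk (U V W : ℝ) (hU0 : 0 < U) (h : U * V = W ^ 2 + 1) :
    ∃ z : ℍ, hU z = U ∧ hV z = V ∧ hW z = W := by
  have hne := hU0.ne'
  have hi : 0 < 1 / U := by positivity
  have hV' : V = (W^2+1)/U := by field_simp; linarith
  refine ⟨⟨⟨W / U, 1 / U⟩, hi⟩, ?_, ?_, ?_⟩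
  · simp [hU, UpperHalfPlane.im]
  · simp only [hV, UpperHalfPlane.im, UpperHalfPlane.re]
    rw [hV']; field_simp
  · simp only [hW, UpperHalfPlane.im, UpperHalfPlane.re]
    field_simp

/-- a line through `z` with unit tangent vector opposite to `(p, q, r)` -/
theorem line_exists (z : ℍ) (p q r : ℝ) (h1 : r ^ 2 - p * q = 1)
    (h2 : hU z * q + p * hV z = 2 * hW z * r) :
    ∃ γ : ℝ → ℍ, (∀ s t : ℝ, dist (γ s) (γ t) = |s - t|) ∧
      ∀ t, hU (γ t) = Real.cosh t * hU z + Real.sinh t * p ∧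
        hV (γ t) = Real.cosh t * hV z + Real.sinh t * q ∧
        hW (γ t) = Real.cosh t * hW z + Real.sinh t * r := by
  have hu := hU_pos z
  have huv := hUV z
  set u := hU z
  set v := hV z
  set w := hW z
  have hp : p ^ 2 ≤ u ^ 2 := by
    have : u ^ 2 - p ^ 2 = (u * r - w * p) ^ 2 := by
      linear_combination (-u^2) * h1 - u * p * h2 + p^2 * huv
    nlinarith [sq_nonneg (u * r - w * p)]
  have key : ∀ t : ℝ, ∃ y : ℍ, hU y = Real.cosh t * u + Real.sinh t * p ∧
        hV y = Real.cosh t * v + Real.sinh t * q ∧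
        hW y = Real.cosh t * w + Real.sinh t * r := by
    intro t
    have hcs := Real.cosh_sq t
    have hc := Real.cosh_pos t
    apply hyp_mk
    · have hp' := abs_le_of_sq_le_sq hp hu.le
      have hsc : |Real.sinh t| < Real.cosh t := by
        apply abs_lt_of_sq_lt_sq _ hc.le
        linarith
      have h3 : |Real.sinh t * p| ≤ |Real.sinh t| * u := by
        rw [abs_mul]
        exact mul_le_mul_of_nonneg_left hp' (abs_nonneg _)
      have h4 := neg_abs_le (Real.sinh t * p)
      nlinarith
    · linear_combination (Real.cosh t)^2 * huv + Real.cosh t * Real.sinh t * h2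
        - (Real.sinh t)^2 * h1 + hcs
  choose γ hγ using key
  refine ⟨γ, ?_, hγ⟩
  intro s t
  obtain ⟨a1, a2, a3⟩ := hγ s
  obtain ⟨b1, b2, b3⟩ := hγ t
  have hc : Real.cosh (dist (γ s) (γ t)) = Real.cosh (s - t) := by
    rw [cosh_hyp, a1, a2, a3, b1, b2, b3, Real.cosh_sub]
    linear_combination Real.cosh s * Real.cosh t * huv
      + (Real.cosh s * Real.sinh t + Real.sinh s * Real.cosh t) / 2 * h2
      - Real.sinh s * Real.sinh t * h1
  have h3 := le_antisymm (Real.cosh_le_cosh.1 hc.le) (Real.cosh_le_cosh.1 hc.ge)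
  rwa [abs_of_nonneg dist_nonneg] at h3

theorem sinh_dist_pos {a z : ℍ} (h : a ≠ z) : 0 < Real.sinh (dist a z) :=
  Real.sinh_pos_iff.2 (dist_pos.2 h)

/-- no branching -/
theorem opp (a z b : ℍ) (ha : a ≠ z) (hb : b ≠ z) (h : dist a z + dist z b = dist a b) :
    (hU b - Real.cosh (dist b z) * hU z) / Real.sinh (dist b z) =
      - ((hU a - Real.cosh (dist a z) * hU z) / Real.sinh (dist a z)) ∧
    (hW b - Real.cosh (dist b z) * hW z) / Real.sinh (dist b z) =
      - ((hW a - Real.cosh (dist a z) * hW z) / Real.sinh (dist a z)) := by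
  have hsa := sinh_dist_pos ha
  have hsb := sinh_dist_pos hb
  have ca := Real.cosh_sq (dist a z)
  have cb := Real.cosh_sq (dist b z)
  have hab : Real.cosh (dist a b) = Real.cosh (dist a z) * Real.cosh (dist b z)
      + Real.sinh (dist a z) * Real.sinh (dist b z) := by
    rw [← h, dist_comm z b, Real.cosh_add]
  rw [cosh_hyp a b] at hab
  have haz := cosh_hyp a z
  have hbz := cosh_hyp b z
  have uz := hU_pos z
  have za := hUV z
  have aa := hUV a
  have bb := hUV b
  generalize Real.cosh (dist a z) = C at *
  generalize Real.sinh (dist a z) = S at *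
  generalize Real.cosh (dist b z) = D at *
  generalize Real.sinh (dist b z) = T at *
  generalize hU a = ua at *
  generalize hU b = ub at *
  generalize hU z = u at *
  generalize hV a = va at *
  generalize hV b = vb at *
  generalize hV z = v at *
  generalize hW a = wa at *
  generalize hW b = wb at *
  generalize hW z = w at *
  set p := S * (ub - D * u) + T * (ua - C * u) with hp
  set q := S * (vb - D * v) + T * (va - C * v) with hq
  set r := S * (wb - D * w) + T * (wa - C * w) with hr
  have n1 : r ^ 2 = p * q := by
    rw [hp, hq, hr]
    linear_combination S^2 * (-bb - 2 * D * hbz - D^2 * za) + T^2 * (-aa - 2 * C * haz - C^2 * za)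
      + 2 * S * T * (-hab - D * haz - C * hbz - C * D * za) + S^2 * cb + T^2 * ca
  have n2 : p * v + q * u = 2 * r * w := by
    rw [hp, hq, hr]
    linear_combination (-2) * S * hbz - 2 * T * haz - 2 * (S * D + T * C) * za
  have n3 : (p * w - r * u) ^ 2 + p ^ 2 = 0 := by
    linear_combination u * p * n2 + u^2 * n1 - p^2 * za
  have p0 : p = 0 := by
    have := sq_nonneg (p * w - r * u)
    have := sq_nonneg p
    exact pow_eq_zero_iff two_ne_zero |>.1 (by linarith)
  have r0 : r = 0 := by
    rw [p0] at n1
    exact pow_eq_zero_iff two_ne_zero |>.1 (by linarith)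
  have := hsa.ne'
  have := hsb.ne'
  constructor
  · field_simp
    linarith
  · field_simp
    linarith

theorem on_line (z a : ℍ) (haz : a ≠ z) :
    ∃ γ : ℝ → ℍ, (∀ s t : ℝ, dist (γ s) (γ t) = |s - t|) ∧
      ∀ b : ℍ, b ≠ z → (hU b - Real.cosh (dist b z) * hU z) / Real.sinh (dist b z) =
          ((hU a - Real.cosh (dist a z) * hU z) / Real.sinh (dist a z)) ∧
        (hW b - Real.cosh (dist b z) * hW z) / Real.sinh (dist b z) =
          ((hW a - Real.cosh (dist a z) * hW z) / Real.sinh (dist a z)) ∨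
        (hU b - Real.cosh (dist b z) * hU z) / Real.sinh (dist b z) =
          - ((hU a - Real.cosh (dist a z) * hU z) / Real.sinh (dist a z)) ∧
        (hW b - Real.cosh (dist b z) * hW z) / Real.sinh (dist b z) =
          - ((hW a - Real.cosh (dist a z) * hW z) / Real.sinh (dist a z)) →
        b ∈ Set.range γ := by
  have hS := sinh_dist_pos haz
  have hC := Real.cosh_sq (dist a z)
  have hc := cosh_hyp a z
  have aa := hUV a
  have zz := hUV z
  obtain ⟨γ, h1, h2⟩ := line_exists z
    ((hU a - Real.cosh (dist a z) * hU z) / Real.sinh (dist a z))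
    ((hV a - Real.cosh (dist a z) * hV z) / Real.sinh (dist a z))
    ((hW a - Real.cosh (dist a z) * hW z) / Real.sinh (dist a z))
    (by
      field_simp
      linear_combination hC - aa - Real.cosh (dist a z)^2 * zz - 2 * Real.cosh (dist a z) * hc)
    (by
      field_simp
      linear_combination (-2) * hc - 2 * Real.cosh (dist a z) * zz)
  refine ⟨γ, h1, ?_⟩
  intro b hb h
  have hT := sinh_dist_pos hb
  rcases h with ⟨e1, e2⟩ | ⟨e1, e2⟩
  · refine ⟨dist b z, hyp_ext _ _ ?_ ?_⟩
    · rw [(h2 _).1, ← e1]; field_simp; ring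
    · rw [(h2 _).2.2, ← e2]; field_simp; ring
  · refine ⟨-dist b z, hyp_ext _ _ ?_ ?_⟩
    · rw [(h2 _).1, Real.cosh_neg, Real.sinh_neg, neg_mul, ← mul_neg, ← e1]; field_simp; ring
    · rw [(h2 _).2.2, Real.cosh_neg, Real.sinh_neg, neg_mul, ← mul_neg, ← e2]; field_simp; ring



theorem optimal_hyperbolic_tour_noncrossing
    {n : ℕ} [NeZero n] (hn : 3 ≤ n)
    (x : Fin n → ℍ) (hinj : Function.Injective x)
    (hopt : ∀ σ : Equiv.Perm (Fin n),
      ∑ k : Fin n, dist (x k) (x (k + 1)) ≤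
        ∑ k : Fin n, dist (x (σ k)) (x (σ (k + 1))))
    (i j : Fin n)
    (hdistinct : ({i, i + 1, j, j + 1} : Finset (Fin n)).card = 4)
    (hnotline : ¬ ∃ γ : ℝ → ℍ, (∀ s t : ℝ, dist (γ s) (γ t) = |s - t|) ∧
      ({x i, x (i + 1), x j, x (j + 1)} : Set ℍ) ⊆ Set.range γ) :
    ¬ ∃ z : ℍ, z ≠ x i ∧ z ≠ x (i + 1) ∧ z ≠ x j ∧ z ≠ x (j + 1) ∧
      dist (x i) z + dist z (x (i + 1)) = dist (x i) (x (i + 1)) ∧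
      dist (x j) z + dist z (x (j + 1)) = dist (x j) (x (j + 1)) := by
  rintro ⟨z, hz1, hz2, hz3, hz4, hb1, hb2⟩
  have hij : i ≠ j := by
    rintro rfl
    have : ({i, i + 1, i, i + 1} : Finset (Fin n)).card ≤ 2 := by
      have : ({i, i + 1, i, i + 1} : Finset (Fin n)) = {i, i+1} := by ext; simp
      rw [this]; exact Finset.card_le_two
    omega
  have h := two_opt_ineq x hopt i j hij
  have t1 := dist_triangle (x i) z (x j)
  have t2 := dist_triangle (x (i+1)) z (x (j+1))
  rw [dist_comm z (x j)] at t1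
  rw [dist_comm (x (i+1)) z] at t2
  have e1 : dist (x i) z + dist z (x j) = dist (x i) (x j) := by
    rw [dist_comm z (x j)]; linarith
  have e2 : dist (x (i+1)) z + dist z (x (j+1)) = dist (x (i+1)) (x (j+1)) := by
    rw [dist_comm (x (i+1)) z]; linarith
  have o1 := opp _ _ _ hz1.symm hz2.symm hb1
  have o2 := opp _ _ _ hz1.symm hz3.symm e1
  have o3 := opp _ _ _ hz2.symm hz4.symm e2
  rw [o1.1, o1.2, neg_neg, neg_neg] at o3
  obtain ⟨γ, g1, g2⟩ := on_line z (x i) hz1.symm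
  refine hnotline ⟨γ, g1, ?_⟩
  rintro y (rfl | rfl | rfl | rfl)
  · exact g2 _ hz1.symm (Or.inl ⟨rfl, rfl⟩)
  · exact g2 _ hz2.symm (Or.inr o1)
  · exact g2 _ hz3.symm (Or.inr o2)
  · exact g2 _ hz4.symm (Or.inl o3)
end

section
/- For every natural number n ≥ 2, Real.arsinh (1 / Real.tan (π / (2 * n))) < Real.log n + 1. -/
open Real

theorem arsinh_inv_tan_lt_log_add_one (n : ℕ) (hn : 2 ≤ n) :
    Real.arsinh (1 / Real.tan (π / (2 * n))) < Real.log n + 1 := by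
  have hn' : (2 : ℝ) ≤ n := by exact_mod_cast hn
  have hpos : (0 : ℝ) < n := by linarith
  have hx : 0 < π / (2 * n) := by positivity
  have hx2 : π / (2 * n) < π / 2 := by
    apply div_lt_div_of_pos_left Real.pi_pos <;> linarith
  have ht := Real.lt_tan hx hx2
  have h1 : 1 / Real.tan (π / (2 * n)) < n := by
    have h2 : 1 / (n : ℝ) < π / (2 * n) := by
      rw [div_lt_div_iff₀ hpos (by positivity)]
      nlinarith [Real.pi_gt_three]
    rw [div_lt_iff₀ (hx.trans ht)]
    rw [div_lt_iff₀ hpos] at h2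
    nlinarith
  rw [← Real.arsinh_sinh (Real.log n + 1), Real.arsinh_lt_arsinh]
  refine h1.trans ?_
  rw [Real.sinh_eq, Real.exp_add, Real.exp_log hpos]
  have hlog : 0 ≤ Real.log n := Real.log_nonneg (by linarith)
  have h3 : Real.exp (-(Real.log n + 1)) ≤ 1 := Real.exp_le_one_iff.2 (by linarith)
  have h4 := Real.exp_one_gt_d9
  have h5 : (n : ℝ) * 2.7 ≤ n * Real.exp 1 := by gcongr; linarith
  linarith
end

section
/- For every natural number n ≥ 1 and every function d : Fin n → AddCircle π (the circle ℝ/πℤ with its quotient norm), there exists a : AddCircle π such that for all i : Fin n, ‖a - d i‖ ≥ π / (2 * n). -/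
open Real

theorem exists_direction_far_from_all
    (n : ℕ) (hn : 1 ≤ n) (d : Fin n → AddCircle π) :
    ∃ a : AddCircle π, ∀ i : Fin n, π / (2 * n) ≤ ‖a - d i‖ := by
  haveI : Fact (0 < π) := ⟨Real.pi_pos⟩
  haveI : Nonempty (Fin n) := ⟨⟨0, hn⟩⟩
  have hne : (Finset.univ : Finset (Fin n)).Nonempty := Finset.univ_nonempty
  have hcont : Continuous (fun a : AddCircle π => Finset.univ.inf' hne (fun i => ‖a - d i‖)) := by
    apply Continuous.finset_inf'_apply
    intro i _
    fun_prop
  obtain ⟨a, -, ha⟩ := isCompact_univ.exists_isMaxOn (Set.univ_nonempty) hcont.continuousOn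
  refine ⟨a, ?_⟩
  by_contra hcon
  push Not at hcon
  obtain ⟨j, hj⟩ := hcon
  set M := Finset.univ.inf' hne (fun i => ‖a - d i‖) with hM
  have hMlt : M < π / (2 * n) := lt_of_le_of_lt (Finset.inf'_le _ (Finset.mem_univ j)) hj
  have hM0 : 0 ≤ M := Finset.le_inf' _ _ (fun i _ => norm_nonneg _)
  have hcov : (Set.univ : Set (AddCircle π)) ⊆ ⋃ i, Metric.closedBall (d i) M := by
    intro b _
    obtain ⟨i, -, hi⟩ := Finset.exists_mem_eq_inf' hne (fun i => ‖b - d i‖)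
    refine Set.mem_iUnion.2 ⟨i, ?_⟩
    rw [Metric.mem_closedBall, dist_eq_norm, ← hi]
    exact ha (Set.mem_univ b)
  have h1 := (MeasureTheory.measure_mono (μ := MeasureTheory.volume) hcov).trans
    (MeasureTheory.measure_iUnion_le _)
  rw [AddCircle.measure_univ, tsum_fintype] at h1
  have h2 : ENNReal.ofReal π ≤ ENNReal.ofReal (n * (2 * M)) := by
    refine h1.trans ?_
    rw [ENNReal.ofReal_mul (by positivity), ENNReal.ofReal_natCast]
    refine (Finset.sum_le_card_nsmul _ _ (ENNReal.ofReal (2 * M)) ?_).trans (by simp)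
    intro i _
    rw [AddCircle.volume_closedBall]
    exact ENNReal.ofReal_le_ofReal (min_le_right _ _)
  rw [ENNReal.ofReal_le_ofReal_iff (by positivity)] at h2
  have hn' : (0 : ℝ) < n := by exact_mod_cast hn
  rw [lt_div_iff₀ (by positivity)] at hMlt
  linarith
end
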